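/- arXiv:0803.1248 — 2 statements merged into one kernel-verified Lean document; each statement's English description precedes it below -/
import Mathlib

section
/- Suppose U, W ∈ W₀ and (Uₙ), (Wₙ) are sequences in W₀ with ‖Uₙ − U‖_□ → 0 and ‖Wₙ − W‖_□ → 0 as n → ∞, and suppose moreover that U(x,y) ∈ {0,1} for almost every (x,y) ∈ [0,1]². Then ‖Uₙ − Wₙ‖₁ → ‖U − W‖₁ as n → ∞. -/
open MeasureTheory Filter Topology
open scoped ENNReal

noncomputable section

/-- The unit interval `[0,1]` as a subset of `ℝ`. -/
def I01 : Set ℝ := Set.Icc 0 1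

/-- `W₀`: symmetric measurable functions `[0,1]² → [0,1]`
(represented as functions `ℝ → ℝ → ℝ`, with the relevant values on `[0,1]²`). -/
def IsGraphon (W : ℝ → ℝ → ℝ) : Prop :=
  Measurable (Function.uncurry W) ∧ (∀ x y, W x y = W y x) ∧
    ∀ x y, W x y ∈ Set.Icc (0 : ℝ) 1

/-- The `L¹` norm of a kernel on `[0,1]²`. -/
def l1Norm (W : ℝ → ℝ → ℝ) : ℝ :=
  ∫ x in I01, ∫ y in I01, |W x y|

/-- The cut norm of a kernel on `[0,1]²`. -/
def cutNorm (W : ℝ → ℝ → ℝ) : ℝ :=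
  sSup { r : ℝ | ∃ S T : Set ℝ, MeasurableSet S ∧ MeasurableSet T ∧ S ⊆ I01 ∧ T ⊆ I01 ∧
    r = |∫ x in S, ∫ y in T, W x y| }

/-- An invertible measure preserving map of `[0,1]`. -/
structure InvMP where
  toFun : ℝ → ℝ
  invFun : ℝ → ℝ
  maps : ∀ x ∈ I01, toFun x ∈ I01
  mapsInv : ∀ x ∈ I01, invFun x ∈ I01
  measurePreserving :
    MeasurePreserving toFun (volume.restrict I01) (volume.restrict I01)
  measurePreservingInv :
    MeasurePreserving invFun (volume.restrict I01) (volume.restrict I01)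
  leftInv : ∀ x ∈ I01, invFun (toFun x) = x
  rightInv : ∀ x ∈ I01, toFun (invFun x) = x

/-- `δ_□`: the cut distance, infimum of the cut norm over invertible measure
preserving transformations of `[0,1]`. -/
def deltaCut (U W : ℝ → ℝ → ℝ) : ℝ :=
  ⨅ φ : InvMP, cutNorm (fun x y => U x y - W (φ.toFun x) (φ.toFun y))

/-- `δ₁`: the `L¹` distance minimized over invertible measure preserving
transformations of `[0,1]`. -/
def delta1 (U W : ℝ → ℝ → ℝ) : ℝ :=
  ⨅ φ : InvMP, l1Norm (fun x y => U x y - W (φ.toFun x) (φ.toFun y))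



/-- A graph property: for each `n`, a set of simple graphs on `Fin n`. -/
def GraphProp := ∀ n : ℕ, Set (SimpleGraph (Fin n))

/-- Invariance under isomorphism (isomorphic graphs necessarily have the same
number of vertices). -/
def IsGraphProperty (P : GraphProp) : Prop :=
  ∀ (n : ℕ) (G H : SimpleGraph (Fin n)), Nonempty (G ≃g H) → (G ∈ P n ↔ H ∈ P n)

/-- The normalized edit distance between graphs on a common vertex set. -/
def graphD1 {n : ℕ} (G H : SimpleGraph (Fin n)) : ℝ :=
  (symmDiff G.edgeSet H.edgeSet).ncard / (n ^ 2 : ℝ)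

/-- The edit distance from a graph to a graph property (∞ if the property
contains no graph on the same number of nodes). -/
def graphD1P {n : ℕ} (G : SimpleGraph (Fin n)) (P : GraphProp) : ℝ≥0∞ :=
  ⨅ (H : SimpleGraph (Fin n)) (_ : H ∈ P n), ENNReal.ofReal (graphD1 G H)

open Classical in
/-- The step function `W_G` associated with a graph `G` on `{1,…,n}`:
its value on `((i−1)/n, i/n] × ((j−1)/n, j/n]` is `1` iff `ij ∈ E(G)`. -/
def graphonOf {n : ℕ} (G : SimpleGraph (Fin n)) : ℝ → ℝ → ℝ := fun x y =>
  if ∃ i j : Fin n, G.Adj i j ∧ x ∈ Set.Ioc (((i : ℕ) : ℝ) / n) ((((i : ℕ) : ℝ) + 1) / n)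
      ∧ y ∈ Set.Ioc (((j : ℕ) : ℝ) / n) ((((j : ℕ) : ℝ) + 1) / n)
  then 1 else 0

/-- `H` is (isomorphic to) an induced subgraph of `G`. -/
def IsInducedSubgraph {n k : ℕ} (G : SimpleGraph (Fin n)) (H : SimpleGraph (Fin k)) : Prop :=
  ∃ f : Fin k ↪ Fin n, ∀ i j, H.Adj i j ↔ G.Adj (f i) (f j)

/-- The subgraph of `G` induced on the vertex subset `S` has property `P`
(as a graph on `k = |S|` nodes). -/
def inducedMem {n : ℕ} (G : SimpleGraph (Fin n)) (S : Finset (Fin n)) (k : ℕ)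
    (P : GraphProp) : Prop :=
  ∃ H : SimpleGraph (Fin k), H ∈ P k ∧
    ∃ f : Fin k ↪ Fin n, (∀ i, f i ∈ S) ∧ ∀ i j, H.Adj i j ↔ G.Adj (f i) (f j)

/-- The number of `k`-element vertex subsets of `G` inducing a subgraph with property `P`. -/
def goodCount {n : ℕ} (G : SimpleGraph (Fin n)) (k : ℕ) (P : GraphProp) : ℕ :=
  {S : Finset (Fin n) | S.card = k ∧ inducedMem G S k P}.ncard

/-- Testability of a graph property (Definition 1.1 of the paper). -/
def GraphTestable (P : GraphProp) : Prop :=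
  ∃ P' : GraphProp, IsGraphProperty P' ∧
    (∀ (n : ℕ) (G : SimpleGraph (Fin n)), G ∈ P n → ∀ k, 1 ≤ k → k ≤ n →
      2 * n.choose k ≤ 3 * goodCount G k P') ∧
    (∀ ε : ℝ, 0 < ε → ∃ kε : ℕ, 1 ≤ kε ∧
      ∀ (n : ℕ) (G : SimpleGraph (Fin n)) (k : ℕ), kε ≤ k → k ≤ n →
        ENNReal.ofReal ε ≤ graphD1P G P →
        3 * goodCount G k P' ≤ n.choose k)

def cube (k : ℕ) : Set (Fin k → ℝ) := Set.univ.pi fun _ => I01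

open Classical in
/-- The homomorphism density `t(F,W)`. -/
def homDensity {k : ℕ} (F : SimpleGraph (Fin k)) (W : ℝ → ℝ → ℝ) : ℝ :=
  ∫ x in cube k, ∏ i : Fin k, ∏ j : Fin k,
    if i < j ∧ F.Adj i j then W (x i) (x j) else 1

open Classical in
/-- The induced density `t_ind(F,W)`. -/
def indDensity {k : ℕ} (F : SimpleGraph (Fin k)) (W : ℝ → ℝ → ℝ) : ℝ :=
  ∫ x in cube k, ∏ i : Fin k, ∏ j : Fin k,
    if i < j then (if F.Adj i j then W (x i) (x j) else 1 - W (x i) (x j)) else 1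

/-- Isomorphism of functions in `W₀`: equality of all homomorphism densities. -/
def GraphonIso (U W : ℝ → ℝ → ℝ) : Prop :=
  ∀ (k : ℕ) (F : SimpleGraph (Fin k)), homDensity F U = homDensity F W

open Classical in
/-- `P(G(k,W) ∈ R')`, the probability that the `W`-random graph on `k` nodes
has property `R'`. -/
def probIn (k : ℕ) (W : ℝ → ℝ → ℝ) (R' : GraphProp) : ℝ :=
  ∑ F : SimpleGraph (Fin k), if F ∈ R' k then indDensity F W else 0

/-- The `L¹` distance from `W` to a set `R` of kernels, with value `∞` for `R = ∅`. -/
def d1SetE (W : ℝ → ℝ → ℝ) (R : Set (ℝ → ℝ → ℝ)) : ℝ≥0∞ :=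
  ⨅ (U : ℝ → ℝ → ℝ) (_ : U ∈ R), ENNReal.ofReal (l1Norm fun x y => W x y - U x y)

/-- The cut-norm distance from `W` to a set `R` of kernels, with value `∞` for `R = ∅`. -/
def dCutSetE (W : ℝ → ℝ → ℝ) (R : Set (ℝ → ℝ → ℝ)) : ℝ≥0∞ :=
  ⨅ (U : ℝ → ℝ → ℝ) (_ : U ∈ R), ENNReal.ofReal (cutNorm fun x y => W x y - U x y)

/-- The open ball `B₁(R,c)` (within `W₀`). -/
def ball1 (R : Set (ℝ → ℝ → ℝ)) (c : ℝ) : Set (ℝ → ℝ → ℝ) :=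
  {W | IsGraphon W ∧ d1SetE W R < ENNReal.ofReal c}

/-- The open ball `B_□(R,c)` (within `W₀`). -/
def ballCut (R : Set (ℝ → ℝ → ℝ)) (c : ℝ) : Set (ℝ → ℝ → ℝ) :=
  {W | IsGraphon W ∧ dCutSetE W R < ENNReal.ofReal c}

/-- A graphon property: a set of graphons invariant under isomorphism. -/
def IsGraphonProperty (R : Set (ℝ → ℝ → ℝ)) : Prop :=
  (∀ W ∈ R, IsGraphon W) ∧
    ∀ U W, IsGraphon U → IsGraphon W → GraphonIso U W → (U ∈ R ↔ W ∈ R)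

/-- A set of graphons is closed if it is closed in the cut norm. -/
def CutClosed (R : Set (ℝ → ℝ → ℝ)) : Prop :=
  ∀ W, IsGraphon W →
    (∀ ε : ℝ, 0 < ε → ∃ U ∈ R, cutNorm (fun x y => W x y - U x y) < ε) → W ∈ R

/-- Testability of a graphon property. -/
def GraphonTestable (R : Set (ℝ → ℝ → ℝ)) : Prop :=
  ∃ R' : GraphProp, IsGraphProperty R' ∧
    (∀ W ∈ R, ∀ k : ℕ, 1 ≤ k → (2 : ℝ) / 3 ≤ probIn k W R') ∧
    (∀ ε : ℝ, 0 < ε → ∃ kε : ℕ, 1 ≤ kε ∧ ∀ k, kε ≤ k → ∀ W, IsGraphon W →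
      ENNReal.ofReal ε ≤ d1SetE W R → probIn k W R' ≤ 1 / 3)

/-- The closure `P̄` of a graph property: limits of convergent sequences
of graphs in `P` with sizes tending to infinity. -/
def closureP (P : GraphProp) : Set (ℝ → ℝ → ℝ) :=
  {W | IsGraphon W ∧ ∃ (n : ℕ → ℕ) (G : ∀ m, SimpleGraph (Fin (n m))),
    (∀ m, G m ∈ P (n m)) ∧ Tendsto n atTop atTop ∧
    Tendsto (fun m => deltaCut (graphonOf (G m)) W) atTop (nhds 0)}

/-- A graph property is robust if graphs whose `W_G` is `d₁`-close to `P̄`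
are themselves close to `P` in edit distance. -/
def Robust (P : GraphProp) : Prop :=
  ∀ ε : ℝ, 0 < ε → ∃ (N : ℕ) (ε' : ℝ), 1 ≤ N ∧ 0 < ε' ∧
    ∀ (n : ℕ), N ≤ n → ∀ G : SimpleGraph (Fin n),
      d1SetE (graphonOf G) (closureP P) ≤ ENNReal.ofReal ε' →
      graphD1P G P ≤ ENNReal.ofReal ε

/-- A hereditary graph property: closed under induced subgraphs. -/
def Hereditary (P : GraphProp) : Prop :=
  ∀ (n : ℕ) (G : SimpleGraph (Fin n)), G ∈ P n →
    ∀ (k : ℕ) (H : SimpleGraph (Fin k)), IsInducedSubgraph G H → H ∈ P k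

/-- `U` is a flexing of `W`: `U ∈ W₀` agrees with `W` wherever `W` takes value `0` or `1`. -/
def Flexing (U W : ℝ → ℝ → ℝ) : Prop :=
  IsGraphon U ∧ ∀ x y, (W x y = 0 ∨ W x y = 1) → U x y = W x y

/-- A function property is flexible if it is preserved under flexing. -/
def FlexibleFamily (R : Set (ℝ → ℝ → ℝ)) : Prop :=
  ∀ W ∈ R, ∀ U, Flexing U W → U ∈ R

/-- `U' ≤ W'` almost everywhere on `[0,1]²`. -/
def aeLE (U W : ℝ → ℝ → ℝ) : Prop :=
  ∀ᵐ p ∂(volume.restrict (I01 ×ˢ I01)), U p.1 p.2 ≤ W p.1 p.2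

/-- `U ⪯ W`: up to isomorphism, `U ≤ W` almost everywhere. -/
def graphonLE (U W : ℝ → ℝ → ℝ) : Prop :=
  ∃ U' W', IsGraphon U' ∧ IsGraphon W' ∧ GraphonIso U U' ∧ GraphonIso W W' ∧ aeLE U' W'

/-- The upward closure of a graph property: graphs having a spanning subgraph in `P`. -/
def upP (P : GraphProp) : GraphProp :=
  fun n => {G | ∃ H : SimpleGraph (Fin n), H ∈ P n ∧ H ≤ G}

/-- The upward closure of a function property. -/
def upR (R : Set (ℝ → ℝ → ℝ)) : Set (ℝ → ℝ → ℝ) :=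
  {W | IsGraphon W ∧ ∃ U ∈ R, graphonLE U W}

/-- A stepfunction: constant on the products of a finite measurable partition of `[0,1]`. -/
def IsStepfunction (W : ℝ → ℝ → ℝ) : Prop :=
  ∃ (m : ℕ) (S : Fin m → Set ℝ), (∀ i, MeasurableSet (S i)) ∧
    (⋃ i, S i) = I01 ∧ (∀ i j, i ≠ j → Disjoint (S i) (S j)) ∧
    ∀ i j : Fin m, ∀ x ∈ S i, ∀ x' ∈ S i, ∀ y ∈ S j, ∀ y' ∈ S j, W x y = W x' y'

open Classical in
/-- A testable graphon functional: its value can be estimated from `W`-random graphs. -/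
def TestableFunctional (f : (ℝ → ℝ → ℝ) → ℝ) : Prop :=
  ∃ g : ∀ n : ℕ, SimpleGraph (Fin n) → ℝ,
    (∀ (n : ℕ) (G H : SimpleGraph (Fin n)), Nonempty (G ≃g H) → g n G = g n H) ∧
    ∀ ε : ℝ, 0 < ε → ∃ kε : ℕ, 1 ≤ kε ∧ ∀ k, kε ≤ k → ∀ W, IsGraphon W →
      (∑ F : SimpleGraph (Fin k), if ε < |f W - g k F| then indDensity F W else 0) < 1 / 3


/-- Lebesgue measure on the unit square. -/
def sqMeas : Measure (ℝ × ℝ) := (volume.restrict I01).prod (volume.restrict I01)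

instance isProb_I01 : IsProbabilityMeasure (volume.restrict I01 : Measure ℝ) :=
  ⟨by simp [I01]⟩

instance isProb_sqMeas : IsProbabilityMeasure sqMeas := by
  unfold sqMeas; infer_instance

theorem measurableSet_I01 : MeasurableSet I01 := measurableSet_Icc

theorem sqMeas_eq : sqMeas = volume.restrict (I01 ×ˢ I01) := by
  unfold sqMeas
  rw [Measure.prod_restrict]; rfl

theorem integrable_bdd {F : ℝ → ℝ → ℝ} (hm : Measurable (Function.uncurry F))
    (hb : ∀ x y, |F x y| ≤ 1) : Integrable (Function.uncurry F) sqMeas :=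
  Integrable.of_bound hm.aestronglyMeasurable 1 (Eventually.of_forall fun p => hb p.1 p.2)

theorem rect_integral {F : ℝ → ℝ → ℝ} (hm : Measurable (Function.uncurry F))
    (hb : ∀ x y, |F x y| ≤ 1) (S T : Set ℝ) (hS : S ⊆ I01) (hT : T ⊆ I01)
    (hSm : MeasurableSet S) (hTm : MeasurableSet T) :
    ∫ x in S, ∫ y in T, F x y = ∫ p in S ×ˢ T, Function.uncurry F p ∂sqMeas := by
  have h : sqMeas.restrict (S ×ˢ T) = (volume.restrict S).prod (volume.restrict T) := by
    unfold sqMeas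
    rw [← Measure.prod_restrict, Measure.restrict_restrict hSm, Measure.restrict_restrict hTm,
      Set.inter_eq_left.mpr hS, Set.inter_eq_left.mpr hT]
  have hi := (integrable_bdd hm hb).integrableOn (s := S ×ˢ T)
  unfold IntegrableOn at hi
  rw [h] at hi ⊢
  rw [integral_prod _ hi]
  rfl

theorem abs_setIntegral_le {F : ℝ → ℝ → ℝ} (hb : ∀ x y, |F x y| ≤ 1) (A : Set (ℝ × ℝ)) :
    |∫ p in A, Function.uncurry F p ∂sqMeas| ≤ sqMeas.real A := by
  have := norm_setIntegral_le_of_norm_le_const (μ := sqMeas) (s := A) (C := 1)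
    (f := Function.uncurry F) (measure_lt_top _ _) (fun p _ => hb p.1 p.2)
  simpa using this

theorem rect_le_cutNorm {F : ℝ → ℝ → ℝ} (hm : Measurable (Function.uncurry F))
    (hb : ∀ x y, |F x y| ≤ 1) (S T : Set ℝ)
    (hSm : MeasurableSet S) (hTm : MeasurableSet T) :
    |∫ p in S ×ˢ T, Function.uncurry F p ∂sqMeas| ≤ cutNorm F := by
  have h1 : ∫ p in S ×ˢ T, Function.uncurry F p ∂sqMeas
      = ∫ p in (S ∩ I01) ×ˢ (T ∩ I01), Function.uncurry F p ∂sqMeas := by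
    rw [sqMeas_eq, Measure.restrict_restrict (hSm.prod hTm), Measure.restrict_restrict
      ((hSm.inter measurableSet_I01).prod (hTm.inter measurableSet_I01)),
      Set.prod_inter_prod, Set.prod_inter_prod, Set.inter_assoc, Set.inter_assoc, Set.inter_self]
  rw [h1]
  apply le_csSup
  · refine ⟨1, ?_⟩
    rintro r ⟨S, T, hS, hT, hS', hT', rfl⟩
    rw [rect_integral hm hb S T hS' hT' hS hT]
    exact (abs_setIntegral_le hb _).trans measureReal_le_one
  · refine ⟨S ∩ I01, T ∩ I01, hSm.inter measurableSet_I01, hTm.inter measurableSet_I01,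
      Set.inter_subset_right, Set.inter_subset_right, ?_⟩
    rw [rect_integral hm hb _ _ Set.inter_subset_right Set.inter_subset_right
      (hSm.inter measurableSet_I01) (hTm.inter measurableSet_I01)]

theorem tendsto_setIntegral {D : ℕ → ℝ → ℝ → ℝ} (hm : ∀ n, Measurable (Function.uncurry (D n)))
    (hb : ∀ n x y, |D n x y| ≤ 1) (hc : Tendsto (fun n => cutNorm (D n)) atTop (nhds 0))
    (A : Set (ℝ × ℝ)) (hA : MeasurableSet A) :
    Tendsto (fun n => ∫ p in A, Function.uncurry (D n) p ∂sqMeas) atTop (nhds 0) := by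
  have hrect : ∀ S T : Set ℝ, MeasurableSet S → MeasurableSet T →
      Tendsto (fun n => ∫ p in S ×ˢ T, Function.uncurry (D n) p ∂sqMeas) atTop (nhds 0) :=
    fun S T hS hT => squeeze_zero_norm (fun n => rect_le_cutNorm (hm n) (hb n) S T hS hT) hc
  have huniv : Tendsto (fun n => ∫ p, Function.uncurry (D n) p ∂sqMeas) atTop (nhds 0) := by
    simpa using hrect Set.univ Set.univ MeasurableSet.univ MeasurableSet.univ
  induction A, hA using MeasurableSpace.induction_on_inter generateFrom_prod.symm isPiSystem_prod with
  | empty => simp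
  | basic t ht =>
    obtain ⟨S, hS, T, hT, rfl⟩ := ht
    exact hrect S T hS hT
  | compl t ht ih =>
    have h : ∀ n, ∫ p in tᶜ, Function.uncurry (D n) p ∂sqMeas
        = (∫ p, Function.uncurry (D n) p ∂sqMeas) - ∫ p in t, Function.uncurry (D n) p ∂sqMeas :=
      fun n => setIntegral_compl ht (integrable_bdd (hm n) (hb n))
    simp_rw [h]
    simpa using huniv.sub ih
  | iUnion f hd hf ih =>
    have h : ∀ n, ∫ p in ⋃ i, f i, Function.uncurry (D n) p ∂sqMeas
        = ∑' i, ∫ p in f i, Function.uncurry (D n) p ∂sqMeas :=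
      fun n => integral_iUnion hf hd (integrable_bdd (hm n) (hb n)).integrableOn
    simp_rw [h]
    have hs : Summable fun i => sqMeas.real (f i) :=
      ENNReal.summable_toReal (by
        rw [← measure_iUnion hd hf]; exact measure_ne_top _ _)
    have := tendsto_tsum_of_dominated_convergence
      (f := fun n i => ∫ p in f i, Function.uncurry (D n) p ∂sqMeas) (g := fun _ => (0 : ℝ))
      hs ih (Eventually.of_forall fun n i => abs_setIntegral_le (hb n) (f i))
    simpa using this

theorem graphon_sub {U V : ℝ → ℝ → ℝ} (hU : IsGraphon U) (hV : IsGraphon V) :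
    Measurable (Function.uncurry fun x y => U x y - V x y) ∧ ∀ x y, |U x y - V x y| ≤ 1 := by
  refine ⟨hU.1.sub hV.1, fun x y => ?_⟩
  have h1 := hU.2.2 x y
  have h2 := hV.2.2 x y
  rw [abs_le]
  constructor <;> linarith [h1.1, h1.2, h2.1, h2.2]

theorem l1Norm_eq {U V : ℝ → ℝ → ℝ} (hU : IsGraphon U) (hV : IsGraphon V) :
    l1Norm (fun x y => U x y - V x y) = ∫ p, |U p.1 p.2 - V p.1 p.2| ∂sqMeas := by
  have h := graphon_sub hU hV
  have hi := (integrable_bdd h.1 h.2).abs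
  unfold l1Norm sqMeas
  exact (integral_prod _ hi).symm

theorem integrable_abs_sub {U V : ℝ → ℝ → ℝ} (hU : IsGraphon U) (hV : IsGraphon V) :
    Integrable (fun p : ℝ × ℝ => |U p.1 p.2 - V p.1 p.2|) sqMeas :=
  (integrable_bdd (graphon_sub hU hV).1 (graphon_sub hU hV).2).abs

theorem tendsto_l1_fixed (U V : ℝ → ℝ → ℝ) (Vseq : ℕ → ℝ → ℝ → ℝ)
    (hU : IsGraphon U) (hV : IsGraphon V) (hVseq : ∀ n, IsGraphon (Vseq n))
    (hc : Tendsto (fun n => cutNorm fun x y => Vseq n x y - V x y) atTop (nhds 0))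
    (hU01 : ∀ᵐ p ∂(volume.restrict (I01 ×ˢ I01)), U p.1 p.2 = 0 ∨ U p.1 p.2 = 1) :
    Tendsto (fun n => l1Norm fun x y => U x y - Vseq n x y) atTop
      (nhds (l1Norm fun x y => U x y - V x y)) := by
  set A : Set (ℝ × ℝ) := Function.uncurry U ⁻¹' {1} with hA
  have hAm : MeasurableSet A := hU.1 (measurableSet_singleton 1)
  have hg := fun n => graphon_sub (hVseq n) hV
  have h1 := tendsto_setIntegral (fun n => (hg n).1) (fun n => (hg n).2) hc A hAm
  have h2 := tendsto_setIntegral (fun n => (hg n).1) (fun n => (hg n).2) hc Set.univ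
    MeasurableSet.univ
  simp only [Measure.restrict_univ] at h2
  rw [← sqMeas_eq] at hU01
  rw [← tendsto_sub_nhds_zero_iff]
  have h3 := h2.sub (h1.const_mul 2)
  simp only [mul_zero, sub_zero] at h3
  refine h3.congr fun n => ?_
  have hi := integrable_bdd (hg n).1 (hg n).2
  rw [l1Norm_eq hU (hVseq n), l1Norm_eq hU hV, ← integral_sub (integrable_abs_sub hU (hVseq n))
    (integrable_abs_sub hU hV), ← integral_indicator hAm, ← integral_const_mul,
    ← integral_sub hi ((hi.indicator hAm).const_mul 2)]
  apply integral_congr_ae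
  filter_upwards [hU01] with p hp
  have b1 := (hVseq n).2.2 p.1 p.2
  have b2 := hV.2.2 p.1 p.2
  rcases hp with hp | hp
  · have : p ∉ A := by simp [hA, Function.uncurry, hp]
    rw [Set.indicator_of_notMem this, hp, zero_sub, zero_sub, abs_neg, abs_neg,
      abs_of_nonneg b1.1, abs_of_nonneg b2.1]
    simp [Function.uncurry]
  · have : p ∈ A := by simp [hA, Function.uncurry, hp]
    rw [Set.indicator_of_mem this, hp, abs_of_nonneg (sub_nonneg.2 b1.2),
      abs_of_nonneg (sub_nonneg.2 b2.2)]
    simp only [Function.uncurry]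
    ring

theorem l1_tendsto_of_cut_tendsto_of_zero_one_valued
    (U W : ℝ → ℝ → ℝ) (Useq Wseq : ℕ → ℝ → ℝ → ℝ)
    (hU : IsGraphon U) (hW : IsGraphon W)
    (hUseq : ∀ n, IsGraphon (Useq n)) (hWseq : ∀ n, IsGraphon (Wseq n))
    (hUconv : Tendsto (fun n => cutNorm fun x y => Useq n x y - U x y) atTop (nhds 0))
    (hWconv : Tendsto (fun n => cutNorm fun x y => Wseq n x y - W x y) atTop (nhds 0))
    (hU01 : ∀ᵐ p ∂(volume.restrict (I01 ×ˢ I01)), U p.1 p.2 = 0 ∨ U p.1 p.2 = 1) :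
    Tendsto (fun n => l1Norm fun x y => Useq n x y - Wseq n x y) atTop
      (nhds (l1Norm fun x y => U x y - W x y)) := by
  have hW' := tendsto_l1_fixed U W Wseq hU hW hWseq hWconv hU01
  have hU' := tendsto_l1_fixed U U Useq hU hU hUseq hUconv hU01
  have h0 : (l1Norm fun x y => U x y - U x y) = 0 := by simp [l1Norm]
  rw [h0] at hU'
  have hd : Tendsto (fun n => (l1Norm fun x y => Useq n x y - Wseq n x y)
      - l1Norm fun x y => U x y - Wseq n x y) atTop (nhds 0) := by
    refine squeeze_zero_norm (fun n => ?_) hU'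
    have i1 := integrable_abs_sub (hUseq n) (hWseq n)
    have i2 := integrable_abs_sub hU (hWseq n)
    have i3 := integrable_abs_sub hU (hUseq n)
    rw [l1Norm_eq (hUseq n) (hWseq n), l1Norm_eq hU (hWseq n), l1Norm_eq hU (hUseq n),
      ← integral_sub i1 i2]
    refine norm_integral_le_of_norm_le i3 (Eventually.of_forall fun p => ?_)
    rw [Real.norm_eq_abs]
    refine (abs_abs_sub_abs_le_abs_sub _ _).trans (le_of_eq ?_)
    rw [sub_sub_sub_cancel_right, abs_sub_comm]
  simpa using hd.add hW'

end
end

section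
/- A graphon property R ⊆ W₀ is testable if and only if for every ε > 0 there is an ε' > 0 such that B_□(R,ε') ⊆ B₁(R,ε). -/
open MeasureTheory Filter Topology
open scoped ENNReal

noncomputable section

/-! ### Cut norm basics -/

/-- The uniform probability measure on the unit interval. -/
abbrev mu : Measure ℝ := volume.restrict I01

instance mu_prob : IsProbabilityMeasure mu := by
  refine ⟨?_⟩
  simp [mu, I01]

/-- Bounded measurable kernels. -/
def Ker (D : ℝ → ℝ → ℝ) : Prop :=
  Measurable (Function.uncurry D) ∧ ∃ C : ℝ, ∀ x y, |D x y| ≤ C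

/-- Measurable functions with values in `[0,1]`. -/
def Wt (f : ℝ → ℝ) : Prop := Measurable f ∧ ∀ x, 0 ≤ f x ∧ f x ≤ 1

theorem int_bd {α : Type*} [MeasurableSpace α] {ν : Measure α} [IsFiniteMeasure ν] {f : α → ℝ}
    (hf : Measurable f) (C : ℝ) (hb : ∀ x, |f x| ≤ C) : Integrable f ν :=
  Integrable.of_bound hf.aestronglyMeasurable C (ae_of_all _ hb)

theorem meas_int {α β : Type*} [MeasurableSpace α] [MeasurableSpace β] {ν : Measure β} [SFinite ν]
    {f : α → β → ℝ} (hf : Measurable (Function.uncurry f)) : Measurable fun x => ∫ y, f x y ∂ν :=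
  (hf.stronglyMeasurable.integral_prod_right).measurable

theorem abs_int_le {α : Type*} [MeasurableSpace α] {ν : Measure α} [IsProbabilityMeasure ν]
    {f : α → ℝ} (C : ℝ) (hb : ∀ x, |f x| ≤ C) : |∫ x, f x ∂ν| ≤ C := by
  have := norm_integral_le_of_norm_le_const (μ := ν) (f := f) (C := C) (ae_of_all _ hb)
  simpa using this

/-- The weighted cut functional. -/
def cutF (D : ℝ → ℝ → ℝ) (f g : ℝ → ℝ) : ℝ := ∫ x, ∫ y, f x * g y * D x y ∂mu ∂mu

theorem Wt.ind {S : Set ℝ} (hS : MeasurableSet S) : Wt (S.indicator 1) := by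
  refine ⟨measurable_one.indicator hS, fun x => ?_⟩
  by_cases h : x ∈ S <;> simp [h]

theorem cutF_ind (D : ℝ → ℝ → ℝ) {S T : Set ℝ} (hS : MeasurableSet S) (hT : MeasurableSet T) :
    cutF D (S.indicator 1) (T.indicator 1) = ∫ x in S, ∫ y in T, D x y ∂mu ∂mu := by
  unfold cutF
  rw [← integral_indicator hS]
  congr 1; ext x
  by_cases hx : x ∈ S
  · rw [Set.indicator_of_mem hx, Set.indicator_of_mem hx, ← integral_indicator hT]
    congr 1; ext y
    by_cases hy : y ∈ T <;> simp [hy]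
  · simp [hx]

theorem restr_sub {S : Set ℝ} (hS : MeasurableSet S) : mu.restrict S = volume.restrict (S ∩ I01) := by
  rw [mu, Measure.restrict_restrict hS]

theorem Ker.bdd {D : ℝ → ℝ → ℝ} {C : ℝ} (hb : ∀ x y, |D x y| ≤ C)
    {S T : Set ℝ} (hS : MeasurableSet S) (hT : MeasurableSet T) :
    |∫ x in S, ∫ y in T, D x y ∂mu ∂mu| ≤ C := by
  rw [← cutF_ind D hS hT]
  have hC : 0 ≤ C := (abs_nonneg _).trans (hb 0 0)
  refine abs_int_le C fun x => abs_int_le C fun y => ?_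
  rw [abs_mul, abs_mul]
  have h1 := (Wt.ind hS).2 x
  have h2 := (Wt.ind hT).2 y
  rw [abs_of_nonneg h1.1, abs_of_nonneg h2.1]
  calc _ ≤ 1 * |D x y| := by
        apply mul_le_mul_of_nonneg_right _ (abs_nonneg _)
        nlinarith
    _ ≤ C := by rw [one_mul]; exact hb x y

theorem cut_le {D : ℝ → ℝ → ℝ} (hD : Ker D) {S T : Set ℝ} (hS : MeasurableSet S)
    (hT : MeasurableSet T) : |∫ x in S, ∫ y in T, D x y ∂mu ∂mu| ≤ cutNorm D := by
  obtain ⟨C, hC⟩ := hD.2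
  refine le_csSup ⟨C, ?_⟩ ?_
  · rintro r ⟨S, T, hS, hT, hS1, hT1, rfl⟩
    have := Ker.bdd hC hS hT
    rwa [restr_sub hS, restr_sub hT, Set.inter_eq_left.2 hS1, Set.inter_eq_left.2 hT1] at this
  · refine ⟨S ∩ I01, T ∩ I01, hS.inter measurableSet_Icc, hT.inter measurableSet_Icc,
      Set.inter_subset_right, Set.inter_subset_right, ?_⟩
    rw [restr_sub hS, restr_sub hT]

theorem cutNorm_le {D : ℝ → ℝ → ℝ} {c : ℝ}
    (h : ∀ f g, Wt f → Wt g → |cutF D f g| ≤ c) : cutNorm D ≤ c := by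
  refine csSup_le ⟨_, ∅, ∅, MeasurableSet.empty, MeasurableSet.empty, by simp, by simp, rfl⟩ ?_
  rintro r ⟨S, T, hS, hT, hS1, hT1, rfl⟩
  have := h _ _ (Wt.ind hS) (Wt.ind hT)
  rwa [cutF_ind D hS hT, restr_sub hS, restr_sub hT, Set.inter_eq_left.2 hS1,
    Set.inter_eq_left.2 hT1] at this

theorem exists_set {f G : ℝ → ℝ} (hf : Wt f) (hG : Measurable G) (C : ℝ) (hC : ∀ x, |G x| ≤ C) :
    ∃ S, MeasurableSet S ∧ |∫ x, f x * G x ∂mu| ≤ |∫ x in S, G x ∂mu| := by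
  have hGi : Integrable G mu := int_bd hG C hC
  have hfi : Integrable (fun x => f x * G x) mu := by
    refine int_bd (hf.1.mul hG) C fun x => ?_
    rw [abs_mul, abs_of_nonneg (hf.2 x).1]
    nlinarith [hf.2 x, hC x, abs_nonneg (G x)]
  rcases le_total 0 (∫ x, f x * G x ∂mu) with h | h
  · refine ⟨{x | 0 < G x}, measurableSet_lt measurable_const hG, ?_⟩
    rw [abs_of_nonneg h]
    refine le_trans ?_ (le_abs_self _)
    rw [← integral_indicator (measurableSet_lt measurable_const hG)]
    refine integral_mono hfi (hGi.indicator (measurableSet_lt measurable_const hG)) fun x => ?_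
    by_cases hx : 0 < G x
    · simp only [Set.indicator, Set.mem_ofPred_eq, hx, if_true]; nlinarith [hf.2 x]
    · simp only [Set.indicator, Set.mem_ofPred_eq, hx, if_false]; nlinarith [hf.2 x]
  · refine ⟨{x | G x < 0}, measurableSet_lt hG measurable_const, ?_⟩
    rw [abs_of_nonpos h]
    refine le_trans ?_ (neg_le_abs _)
    rw [← integral_indicator (measurableSet_lt hG measurable_const)]
    refine neg_le_neg (integral_mono (hGi.indicator (measurableSet_lt hG measurable_const))
      hfi fun x => ?_)
    by_cases hx : G x < 0
    · simp only [Set.indicator, Set.mem_ofPred_eq, hx, if_true]; nlinarith [hf.2 x]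
    · simp only [Set.indicator, Set.mem_ofPred_eq, hx, if_false]; nlinarith [hf.2 x]

theorem Ker.meas₂ {D : ℝ → ℝ → ℝ} (hD : Ker D) {α : Type*} [MeasurableSpace α] {f g : α → ℝ}
    (hf : Measurable f) (hg : Measurable g) : Measurable fun a => D (f a) (g a) :=
  hD.1.comp (hf.prodMk hg)

theorem Ker.mul_wt {D : ℝ → ℝ → ℝ} (hD : Ker D) {f g : ℝ → ℝ} (hf : Wt f) (hg : Wt g) :
    Ker fun x y => f x * g y * D x y := by
  obtain ⟨C, hC⟩ := hD.2
  refine ⟨?_, C, fun x y => ?_⟩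
  · exact ((hf.1.comp measurable_fst).mul (hg.1.comp measurable_snd)).mul hD.1
  · rw [abs_mul, abs_mul, abs_of_nonneg (hf.2 x).1, abs_of_nonneg (hg.2 y).1]
    have h1 := hf.2 x
    have h2 := hg.2 y
    calc _ ≤ 1 * |D x y| := by
          apply mul_le_mul_of_nonneg_right _ (abs_nonneg _)
          nlinarith
      _ ≤ C := by rw [one_mul]; exact hC x y

theorem Ker.integrable {D : ℝ → ℝ → ℝ} (hD : Ker D) {ν ν' : Measure ℝ} [IsFiniteMeasure ν]
    [IsFiniteMeasure ν'] :
    Integrable (Function.uncurry D) (ν.prod ν') := by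
  obtain ⟨C, hC⟩ := hD.2
  exact int_bd hD.1 C fun p => hC p.1 p.2

theorem Wt.one : Wt fun _ => 1 := ⟨measurable_const, fun _ => by norm_num⟩

theorem cutF_swap {D : ℝ → ℝ → ℝ} (hD : Ker D) {f g : ℝ → ℝ} (hf : Wt f) (hg : Wt g) :
    cutF D f g = cutF (fun x y => D y x) g f := by
  unfold cutF
  rw [integral_integral_swap (hD.mul_wt hf hg).integrable]
  simp only [mul_comm (f _) (g _)]

theorem Ker.swap {D : ℝ → ℝ → ℝ} (hD : Ker D) : Ker fun x y => D y x :=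
  ⟨hD.1.comp measurable_swap, hD.2.imp fun _ h x y => h y x⟩

theorem exists_set2 {D : ℝ → ℝ → ℝ} (hD : Ker D) {f g : ℝ → ℝ} (hf : Wt f) (hg : Wt g) :
    ∃ S, MeasurableSet S ∧ |cutF D f g| ≤ |cutF D (S.indicator 1) g| := by
  obtain ⟨C, hC⟩ := hD.2
  have hm : Ker fun x y => g y * D x y := by
    have := hD.mul_wt Wt.one hg
    simpa using this
  obtain ⟨C, hC⟩ := hm.2
  obtain ⟨S, hS, h⟩ := exists_set hf (G := fun x => ∫ y, g y * D x y ∂mu)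
    (meas_int hm.1) C (fun x => abs_int_le C (hC x))
  refine ⟨S, hS, ?_⟩
  rw [← integral_indicator hS] at h
  unfold cutF
  convert h using 2
  · congr 1; ext x; rw [← integral_const_mul]; simp only [mul_assoc]
  · congr 1; ext x
    by_cases hx : x ∈ S <;> simp [hx]

theorem cutF_le {D : ℝ → ℝ → ℝ} (hD : Ker D) {f g : ℝ → ℝ} (hf : Wt f) (hg : Wt g) :
    |cutF D f g| ≤ cutNorm D := by
  obtain ⟨S, hS, h1⟩ := exists_set2 hD hf hg
  rw [cutF_swap hD (Wt.ind hS) hg] at h1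
  obtain ⟨T, hT, h2⟩ := exists_set2 hD.swap hg (Wt.ind hS)
  rw [cutF_swap hD.swap (Wt.ind hT) (Wt.ind hS)] at h2
  refine h1.trans (h2.trans ?_)
  rw [cutF_ind _ hS hT]
  exact cut_le hD hS hT

theorem cutNorm_nonneg {D : ℝ → ℝ → ℝ} (hD : Ker D) : 0 ≤ cutNorm D :=
  (abs_nonneg _).trans (cutF_le hD Wt.one Wt.one)

theorem Ker.add {D E : ℝ → ℝ → ℝ} (hD : Ker D) (hE : Ker E) : Ker fun x y => D x y + E x y := by
  obtain ⟨C, hC⟩ := hD.2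
  obtain ⟨C', hC'⟩ := hE.2
  exact ⟨hD.1.add hE.1, C + C', fun x y => (abs_add_le _ _).trans (add_le_add (hC x y) (hC' x y))⟩

theorem Ker.neg {D : ℝ → ℝ → ℝ} (hD : Ker D) : Ker fun x y => - D x y := by
  obtain ⟨C, hC⟩ := hD.2
  exact ⟨hD.1.neg, C, fun x y => by rw [abs_neg]; exact hC x y⟩

theorem Ker.sub {D E : ℝ → ℝ → ℝ} (hD : Ker D) (hE : Ker E) : Ker fun x y => D x y - E x y := by
  simpa [sub_eq_add_neg] using hD.add hE.neg

theorem cutF_add {D E : ℝ → ℝ → ℝ} (hD : Ker D) (hE : Ker E) {f g : ℝ → ℝ} (hf : Wt f)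
    (hg : Wt g) : cutF (fun x y => D x y + E x y) f g = cutF D f g + cutF E f g := by
  unfold cutF
  have h1 := hD.mul_wt hf hg
  have h2 := hE.mul_wt hf hg
  have := integral_integral_add (μ := mu) (ν := mu) h1.integrable h2.integrable
  simp only [mul_add]
  exact this

theorem cutNorm_add_le {D E : ℝ → ℝ → ℝ} (hD : Ker D) (hE : Ker E) :
    cutNorm (fun x y => D x y + E x y) ≤ cutNorm D + cutNorm E := by
  refine cutNorm_le fun f g hf hg => ?_
  rw [cutF_add hD hE hf hg]
  exact (abs_add_le _ _).trans (add_le_add (cutF_le hD hf hg) (cutF_le hE hf hg))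

theorem cutNorm_neg (D : ℝ → ℝ → ℝ) : cutNorm (fun x y => - D x y) = cutNorm D := by
  unfold cutNorm
  simp only [integral_neg, abs_neg]

theorem cutNorm_sub_comm (D E : ℝ → ℝ → ℝ) :
    cutNorm (fun x y => D x y - E x y) = cutNorm (fun x y => E x y - D x y) := by
  rw [← cutNorm_neg]; simp

/-- Weights in `[-1,1]`. -/
theorem cut4 {D : ℝ → ℝ → ℝ} (hD : Ker D) {f g : ℝ → ℝ} (hf : Measurable f) (hg : Measurable g)
    (hf1 : ∀ x, |f x| ≤ 1) (hg1 : ∀ x, |g x| ≤ 1) :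
    |∫ x, ∫ y, f x * g y * D x y ∂mu ∂mu| ≤ 4 * cutNorm D := by
  have pos : ∀ f : ℝ → ℝ, Measurable f → (∀ x, |f x| ≤ 1) → Wt fun x => max (f x) 0 := by
    intro f hf hf1
    refine ⟨hf.max measurable_const, fun x => ⟨le_max_right _ _, ?_⟩⟩
    exact max_le ((le_abs_self _).trans (hf1 x)) zero_le_one
  have fp := pos f hf hf1
  have gp := pos g hg hg1
  have fn := pos (fun x => - f x) hf.neg (by simpa using hf1)
  have gn := pos (fun x => - g x) hg.neg (by simpa using hg1)
  have dec : ∀ a : ℝ, a = max a 0 - max (-a) 0 := by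
    intro a
    rcases le_total 0 a with h | h
    · rw [max_eq_left h, max_eq_right (by linarith)]; ring
    · rw [max_eq_right h, max_eq_left (by linarith)]; ring
  have k1 := (hD.mul_wt fp gp)
  have k2 := (hD.mul_wt fn gn)
  have k3 := (hD.mul_wt fp gn)
  have k4 := (hD.mul_wt fn gp)
  have e : (∫ x, ∫ y, f x * g y * D x y ∂mu ∂mu) =
      (cutF D (fun x => max (f x) 0) (fun x => max (g x) 0) +
      cutF D (fun x => max (-f x) 0) (fun x => max (-g x) 0)) -
      (cutF D (fun x => max (f x) 0) (fun x => max (-g x) 0) +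
      cutF D (fun x => max (-f x) 0) (fun x => max (g x) 0)) := by
    unfold cutF
    have s1 := integral_integral_add (μ := mu) (ν := mu) k1.integrable k2.integrable
    have s2 := integral_integral_add (μ := mu) (ν := mu) k3.integrable k4.integrable
    have s3 := integral_integral_sub (μ := mu) (ν := mu) (k1.add k2).integrable
      (k3.add k4).integrable
    simp only [Function.uncurry_apply_pair] at s1 s2 s3
    beta_reduce
    rw [← s1, ← s2, ← s3]
    congr 1; ext x; congr 1; ext y
    conv_lhs => rw [dec (f x), dec (g y)]
    ring
  rw [e]
  have a1 := abs_le.1 (cutF_le hD fp gp)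
  have a2 := abs_le.1 (cutF_le hD fn gn)
  have a3 := abs_le.1 (cutF_le hD fp gn)
  have a4 := abs_le.1 (cutF_le hD fn gp)
  rw [abs_le]
  constructor <;> linarith [a1.1, a1.2, a2.1, a2.2, a3.1, a3.2, a4.1, a4.2]

/-- `L¹`-type bound. -/
theorem cutNorm_le_int {D : ℝ → ℝ → ℝ} (hD : Ker D) {b : ℝ → ℝ → ℝ} (hb : Ker b)
    (h : ∀ x y, |D x y| ≤ b x y) : cutNorm D ≤ ∫ x, ∫ y, b x y ∂mu ∂mu := by
  refine cutNorm_le fun f g hf hg => ?_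
  have k := hD.mul_wt hf hg
  unfold cutF
  rw [integral_integral k.integrable, integral_integral hb.integrable]
  refine (abs_integral_le_integral_abs).trans (integral_mono k.integrable.abs hb.integrable ?_)
  rintro ⟨x, y⟩
  simp only
  rw [abs_mul, abs_mul, abs_of_nonneg (hf.2 x).1, abs_of_nonneg (hg.2 y).1]
  have h1 := hf.2 x
  have h2 := hg.2 y
  calc _ ≤ 1 * |D x y| := by
        apply mul_le_mul_of_nonneg_right _ (abs_nonneg _)
        nlinarith
    _ ≤ b x y := by rw [one_mul]; exact h x y

theorem cutNorm_labels {ι : Type*} [Finite ι] [MeasurableSpace ι] [MeasurableSingletonClass ι]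
    (h : ι → ι → ℝ) (hh : ∀ a b, 0 ≤ h a b ∧ h a b ≤ 1) {q r : ℝ → ι}
    (hq : Measurable q) (hr : Measurable r) :
    cutNorm (fun x y => h (q x) (q y) - h (r x) (r y)) ≤ 2 * mu.real {x | q x ≠ r x} := by
  classical
  set B : Set ℝ := {x | q x ≠ r x} with hB
  have hBm : MeasurableSet B := by
    have : MeasurableSet {x | q x = r x} := measurableSet_eq_fun hq hr
    exact this.compl
  have hm : Measurable (Function.uncurry h) := measurable_of_finite _
  have hD : Ker (fun x y => h (q x) (q y) - h (r x) (r y)) := by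
    refine ⟨?_, 1, fun x y => ?_⟩
    · exact (hm.comp ((hq.comp measurable_fst).prodMk (hq.comp measurable_snd))).sub
        (hm.comp ((hr.comp measurable_fst).prodMk (hr.comp measurable_snd)))
    · rw [abs_le]; have := hh (q x) (q y); have := hh (r x) (r y); constructor <;> linarith
  have hb : Ker fun x y => B.indicator (1 : ℝ → ℝ) x + B.indicator (1 : ℝ → ℝ) y := by
    refine ⟨((Wt.ind hBm).1.comp measurable_fst).add ((Wt.ind hBm).1.comp measurable_snd), 2,
      fun x y => ?_⟩
    have := (Wt.ind hBm).2 x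
    have := (Wt.ind hBm).2 y
    rw [abs_le]; constructor <;> linarith
  refine (cutNorm_le_int hD hb ?_).trans (le_of_eq ?_)
  · intro x y
    have hx0 := (Wt.ind hBm).2 x
    have hy0 := (Wt.ind hBm).2 y
    have h1 : |h (q x) (q y) - h (r x) (r y)| ≤ 1 := by
      rw [abs_le]; have := hh (q x) (q y); have := hh (r x) (r y); constructor <;> linarith
    by_cases hx : x ∈ B
    · rw [Set.indicator_of_mem hx] at hx0 ⊢
      simp only [Pi.one_apply]; linarith
    · by_cases hy : y ∈ B
      · rw [Set.indicator_of_mem hy] at hy0 ⊢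
        simp only [Pi.one_apply]; linarith
      · have e1 : q x = r x := by simpa [hB] using hx
        have e2 : q y = r y := by simpa [hB] using hy
        rw [e1, e2]; simp [hx, hy]
  · have hi : Integrable (B.indicator (1 : ℝ → ℝ)) mu := (integrable_const (1:ℝ)).indicator hBm
    have e : ∀ x, ∫ y, (B.indicator (1 : ℝ → ℝ) x + B.indicator (1 : ℝ → ℝ) y) ∂mu =
        B.indicator (1 : ℝ → ℝ) x + mu.real B := by
      intro x
      rw [integral_add (integrable_const _) hi, integral_indicator_one hBm]; simp
    simp only [e]
    rw [integral_add hi (integrable_const _), integral_indicator_one hBm]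
    simp; ring

/-- The cut norm does not increase under measure preserving pullback. -/
theorem cutNorm_pullback {D : ℝ → ℝ → ℝ} (hD : Ker D) {χ : ℝ → ℝ}
    (hχ : MeasurePreserving χ mu mu) :
    cutNorm (fun x y => D (χ x) (χ y)) ≤ cutNorm D := by
  have key : ∀ S : Set ℝ, MeasurableSet S → ∃ f, Wt f ∧ ∀ G : ℝ → ℝ, Measurable G →
      ∫ x in S, G (χ x) ∂mu = ∫ u, f u * G u ∂mu := by
    intro S hS
    set ν : Measure ℝ := (mu.restrict S).map χ with hν
    have hle : ν ≤ mu := by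
      rw [← hχ.map_eq]
      exact Measure.map_mono Measure.restrict_le_self hχ.measurable
    have hac : ν ≪ mu := Measure.absolutelyContinuous_of_le hle
    have h1 := Measure.rnDeriv_le_one_of_le hle
    refine ⟨fun u => min (ν.rnDeriv mu u).toReal 1, ⟨?_, fun u => ⟨?_, min_le_right _ _⟩⟩, ?_⟩
    · exact (Measure.measurable_rnDeriv ν mu).ennreal_toReal.min measurable_const
    · exact le_min ENNReal.toReal_nonneg zero_le_one
    · intro G hG
      have e1 : ∫ x in S, G (χ x) ∂mu = ∫ u, G u ∂ν := by
        rw [hν, integral_map hχ.measurable.aemeasurable hG.aestronglyMeasurable]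
      rw [e1, ← integral_rnDeriv_smul hac]
      refine integral_congr_ae ?_
      filter_upwards [h1] with u hu
      have : (ν.rnDeriv mu u).toReal ≤ 1 := by
        have := ENNReal.toReal_mono ENNReal.one_ne_top hu
        simpa using this
      simp only [smul_eq_mul, min_eq_left this]
  have hcomp : Ker (fun x y => D (χ x) (χ y)) :=
    ⟨hD.1.comp ((hχ.measurable.comp measurable_fst).prodMk (hχ.measurable.comp measurable_snd)),
      hD.2.imp fun C h x y => h _ _⟩
  refine csSup_le ⟨_, ∅, ∅, MeasurableSet.empty, MeasurableSet.empty, by simp, by simp, rfl⟩ ?_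
  rintro r ⟨S, T, hS, hT, hS1, hT1, rfl⟩
  have hS2 := restr_sub hS
  have hT2 := restr_sub hT
  rw [Set.inter_eq_left.2 hS1] at hS2
  rw [Set.inter_eq_left.2 hT1] at hT2
  rw [← hS2, ← hT2]
  obtain ⟨f, hf, hf'⟩ := key S hS
  obtain ⟨g, hg, hg'⟩ := key T hT
  have kg : Ker fun x y => g y * D x y := by
    have := hD.mul_wt Wt.one hg
    simpa using this
  have e : ∫ x in S, ∫ y in T, D (χ x) (χ y) ∂mu ∂mu = cutF D f g := by
    have e1 : ∀ x, ∫ y in T, D (χ x) (χ y) ∂mu = ∫ v, g v * D (χ x) v ∂mu := fun x =>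
      hg' (fun v => D (χ x) v) (hD.meas₂ measurable_const measurable_id)
    simp only [e1]
    rw [hf' (fun u => ∫ v, g v * D u v ∂mu) (meas_int kg.1)]
    unfold cutF
    congr 1; ext x
    rw [← integral_const_mul]; simp only [mul_assoc]
  rw [e]
  exact cutF_le hD hf hg

theorem IsGraphon.ker {W : ℝ → ℝ → ℝ} (hW : IsGraphon W) : Ker W :=
  ⟨hW.1, 1, fun x y => by rw [abs_of_nonneg (hW.2.2 x y).1]; exact (hW.2.2 x y).2⟩

/-! ### Resampling of coordinates and the counting lemma -/

/-- The uniform measure on the cube. -/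
abbrev piMu (k : ℕ) : Measure (Fin k → ℝ) := Measure.pi fun _ => mu

theorem cube_restrict (k : ℕ) : (volume : Measure (Fin k → ℝ)).restrict (cube k) = piMu k := by
  rw [volume_pi, cube, Measure.restrict_pi_pi]

theorem mp_update {k : ℕ} (i : Fin k) :
    MeasurePreserving (fun p : (Fin k → ℝ) × ℝ => Function.update p.1 i p.2)
      ((piMu k).prod mu) (piMu k) := by
  have hm : Measurable (fun p : (Fin k → ℝ) × ℝ => Function.update p.1 i p.2) := by
    rw [measurable_pi_iff]
    intro j
    by_cases h : j = i
    · subst h; simpa using measurable_snd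
    · simp only [Function.update_of_ne h]
      exact (measurable_pi_apply j).comp measurable_fst
  refine ⟨hm, ?_⟩
  symm
  refine Measure.pi_eq fun s hs => ?_
  rw [Measure.map_apply hm (MeasurableSet.univ_pi hs)]
  have e : (fun p : (Fin k → ℝ) × ℝ => Function.update p.1 i p.2) ⁻¹' (Set.univ.pi s) =
      (Set.univ.pi (Function.update s i Set.univ)) ×ˢ s i := by
    ext ⟨x, t⟩
    simp only [Set.mem_preimage, Set.mem_pi, Set.mem_univ, true_imp_iff, Set.mem_prod]
    constructor
    · intro h
      refine ⟨fun j => ?_, by simpa using h i⟩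
      by_cases hj : j = i
      · subst hj; simp
      · simpa [Function.update_of_ne hj] using h j
    · rintro ⟨h, ht⟩ j
      by_cases hj : j = i
      · subst hj; simpa using ht
      · simpa [Function.update_of_ne hj] using h j
  rw [e, Measure.prod_prod, Measure.pi_pi]
  rw [← Finset.mul_prod_erase Finset.univ _ (Finset.mem_univ i),
    ← Finset.mul_prod_erase Finset.univ (fun j => mu (s j)) (Finset.mem_univ i)]
  simp only [Function.update_self, measure_univ, one_mul]
  rw [mul_comm]
  congr 1
  refine Finset.prod_congr rfl fun j hj => ?_
  rw [Function.update_of_ne (Finset.ne_of_mem_erase hj)]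

theorem resample {k : ℕ} (i : Fin k) {f : (Fin k → ℝ) → ℝ} (hf : Measurable f) (C : ℝ)
    (hC : ∀ x, |f x| ≤ C) :
    ∫ x, f x ∂(piMu k) = ∫ x, ∫ s, f (Function.update x i s) ∂mu ∂(piMu k) := by
  have h := mp_update (k := k) i
  conv_lhs => rw [← h.map_eq]
  rw [integral_map h.measurable.aemeasurable hf.aestronglyMeasurable]
  rw [integral_prod]
  exact int_bd (hf.comp h.measurable) C fun p => hC _

theorem two_coord {k : ℕ} {i j : Fin k} (hij : i ≠ j) {D : ℝ → ℝ → ℝ} (hD : Ker D)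
    {A B : (Fin k → ℝ) → ℝ} (hA : Measurable A) (hB : Measurable B)
    (hA1 : ∀ x, |A x| ≤ 1) (hB1 : ∀ x, |B x| ≤ 1)
    (hA2 : ∀ x t, A (Function.update x j t) = A x)
    (hB2 : ∀ x s, B (Function.update x i s) = B x) :
    |∫ x, A x * B x * D (x i) (x j) ∂(piMu k)| ≤ 4 * cutNorm D := by
  obtain ⟨C, hC⟩ := hD.2
  have mD : Measurable fun x : Fin k → ℝ => D (x i) (x j) :=
    hD.meas₂ (measurable_pi_apply i) (measurable_pi_apply j)
  have mF : Measurable fun x => A x * B x * D (x i) (x j) := (hA.mul hB).mul mD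
  have bF : ∀ x, |A x * B x * D (x i) (x j)| ≤ C := by
    intro x
    rw [abs_mul, abs_mul]
    calc _ ≤ 1 * |D (x i) (x j)| := by
          apply mul_le_mul_of_nonneg_right _ (abs_nonneg _)
          exact mul_le_one₀ (hA1 x) (abs_nonneg _) (hB1 x)
      _ ≤ C := by rw [one_mul]; exact hC _ _
  rw [resample j mF C bF]
  have mG : Measurable fun x => ∫ t, A (Function.update x j t) * B (Function.update x j t) *
      D ((Function.update x j t) i) ((Function.update x j t) j) ∂mu :=
    meas_int (mF.comp (mp_update j).measurable)
  rw [resample i mG C (fun x => abs_int_le C fun t => bF _)]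
  refine abs_int_le _ fun x => ?_
  have hupd : ∀ i : Fin k, Measurable fun s : ℝ => Function.update x i s := fun i =>
    measurable_update x
  have := cut4 hD (f := fun s => A (Function.update x i s))
    (g := fun t => B (Function.update x j t)) (hA.comp (hupd i)) (hB.comp (hupd j))
    (fun s => hA1 _) (fun t => hB1 _)
  refine le_trans (le_of_eq ?_) this
  congr 2; ext s; congr 1; ext t
  rw [hA2, Function.update_self, Function.update_of_ne hij, Function.update_self,
    Function.update_comm hij, hB2]

/-- Ordered pairs. -/
abbrev Epr (k : ℕ) : Type := {e : Fin k × Fin k // e.1 < e.2}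

/-- A kernel with values in `[0,1]`. -/
def K01 (H : ℝ → ℝ → ℝ) : Prop :=
  Measurable (Function.uncurry H) ∧ ∀ x y, 0 ≤ H x y ∧ H x y ≤ 1

theorem K01.ker {H : ℝ → ℝ → ℝ} (h : K01 H) : Ker H :=
  ⟨h.1, 1, fun x y => by rw [abs_of_nonneg (h.2 x y).1]; exact (h.2 x y).2⟩

theorem prod_meas {k : ℕ} {H : Epr k → ℝ → ℝ → ℝ} (hH : ∀ e, K01 (H e)) (s : Finset (Epr k)) :
    Measurable fun x : Fin k → ℝ => ∏ e ∈ s, H e (x e.1.1) (x e.1.2) :=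
  Finset.measurable_prod _ fun e _ =>
    (hH e).ker.meas₂ (measurable_pi_apply _) (measurable_pi_apply _)

theorem prod_bd {k : ℕ} {H : Epr k → ℝ → ℝ → ℝ} (hH : ∀ e, K01 (H e)) (s : Finset (Epr k))
    (x : Fin k → ℝ) : |∏ e ∈ s, H e (x e.1.1) (x e.1.2)| ≤ 1 := by
  rw [abs_of_nonneg (Finset.prod_nonneg fun e _ => ((hH e).2 _ _).1)]
  exact Finset.prod_le_one (fun e _ => ((hH e).2 _ _).1) fun e _ => ((hH e).2 _ _).2

theorem hybrid_step {k : ℕ} {H : Epr k → ℝ → ℝ → ℝ} (hH : ∀ e, K01 (H e)) (e : Epr k)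
    {D : ℝ → ℝ → ℝ} (hD : Ker D) :
    |∫ x, (∏ e' ∈ Finset.univ.erase e, H e' (x e'.1.1) (x e'.1.2)) * D (x e.1.1) (x e.1.2)
      ∂(piMu k)| ≤ 4 * cutNorm D := by
  classical
  set s := Finset.univ.erase e with hs
  set s1 := s.filter (fun e' => e'.1.1 = e.1.1 ∨ e'.1.2 = e.1.1) with hs1
  set s2 := s.filter (fun e' => ¬ (e'.1.1 = e.1.1 ∨ e'.1.2 = e.1.1)) with hs2
  have := two_coord (i := e.1.1) (j := e.1.2) (ne_of_lt e.2) hD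
    (A := fun x => ∏ e ∈ s1, H e (x e.1.1) (x e.1.2))
    (B := fun x => ∏ e ∈ s2, H e (x e.1.1) (x e.1.2))
    (prod_meas hH _) (prod_meas hH _) (prod_bd hH _) (prod_bd hH _) ?_ ?_
  · refine le_trans (le_of_eq ?_) this
    congr 2; ext x
    rw [hs1, hs2, Finset.prod_filter_mul_prod_filter_not]
  · intro x t
    refine Finset.prod_congr rfl fun e' he' => ?_
    rw [hs1, Finset.mem_filter, hs, Finset.mem_erase] at he'
    obtain ⟨⟨hne, -⟩, h⟩ := he'
    have l := e.2
    have l' := e'.2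
    have hne' : ¬ (e'.1.1 = e.1.1 ∧ e'.1.2 = e.1.2) := fun h =>
      hne (Subtype.ext (Prod.ext h.1 h.2))
    rw [Function.update_of_ne, Function.update_of_ne]
    · intro h2
      rcases h with h | h
      · exact hne' ⟨h, h2⟩
      · rw [h] at h2; exact absurd h2 (ne_of_lt l)
    · intro h2
      rcases h with h | h
      · rw [h] at h2; exact absurd h2 (ne_of_lt l)
      · rw [h2, h] at l'; exact absurd l' (lt_asymm l)
  · intro x t
    refine Finset.prod_congr rfl fun e' he' => ?_
    rw [hs2, Finset.mem_filter] at he'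
    push Not at he'
    rw [Function.update_of_ne he'.2.1, Function.update_of_ne he'.2.2]

theorem hybrid {k : ℕ} {H H' : Epr k → ℝ → ℝ → ℝ} (hH : ∀ e, K01 (H e)) (hH' : ∀ e, K01 (H' e))
    (c : ℝ) (hc : ∀ e, cutNorm (fun x y => H e x y - H' e x y) ≤ c) (s : Finset (Epr k)) :
    |∫ x, (∏ e, (if e ∈ s then H e else H' e) (x e.1.1) (x e.1.2)) ∂(piMu k) -
      ∫ x, (∏ e, H' e (x e.1.1) (x e.1.2)) ∂(piMu k)| ≤ s.card * (4 * c) := by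
  classical
  induction s using Finset.induction_on with
  | empty => simp
  | insert e s he ih =>
    set M : Finset (Epr k) → Epr k → ℝ → ℝ → ℝ := fun s e => if e ∈ s then H e else H' e with hM
    have hMk : ∀ s e, K01 (M s e) := by
      intro s e
      by_cases h : e ∈ s
      · simpa [hM, h] using hH e
      · simpa [hM, h] using hH' e
    have hint : ∀ s, Integrable (fun x : Fin k → ℝ => ∏ e, M s e (x e.1.1) (x e.1.2)) (piMu k) :=
      fun s => int_bd (prod_meas (hMk s) _) 1 (prod_bd (hMk s) _)
    have step := hybrid_step (hMk s) e ((hH e).ker.sub (hH' e).ker)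
    have eq : (∫ x, (∏ e', M (insert e s) e' (x e'.1.1) (x e'.1.2)) ∂(piMu k)) -
        ∫ x, (∏ e', M s e' (x e'.1.1) (x e'.1.2)) ∂(piMu k) =
        ∫ x, (∏ e' ∈ Finset.univ.erase e, M s e' (x e'.1.1) (x e'.1.2)) *
          (H e (x e.1.1) (x e.1.2) - H' e (x e.1.1) (x e.1.2)) ∂(piMu k) := by
      rw [← integral_sub (hint _) (hint _)]
      congr 1; ext x
      rw [← Finset.mul_prod_erase _ _ (Finset.mem_univ e),
        ← Finset.mul_prod_erase _ (fun e' => M s e' (x e'.1.1) (x e'.1.2)) (Finset.mem_univ e)]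
      have e1 : ∏ e' ∈ Finset.univ.erase e, M (insert e s) e' (x e'.1.1) (x e'.1.2) =
          ∏ e' ∈ Finset.univ.erase e, M s e' (x e'.1.1) (x e'.1.2) := by
        refine Finset.prod_congr rfl fun e' he' => ?_
        simp [hM, Finset.ne_of_mem_erase he']
      rw [e1]
      simp only [hM, Finset.mem_insert_self, if_true, he, if_false]
      ring
    rw [Finset.card_insert_of_notMem he]
    push_cast
    have hc' := hc e
    rw [← eq] at step
    have h1 := abs_le.1 step
    have h2 := abs_le.1 ih
    rw [abs_le]
    simp only [hM] at h1
    constructor <;> nlinarith [h1.1, h1.2, h2.1, h2.2]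

open Classical in
/-- The edge factor of the induced density. -/
def eK {k : ℕ} (F : SimpleGraph (Fin k)) (W : ℝ → ℝ → ℝ) (e : Epr k) : ℝ → ℝ → ℝ :=
  if F.Adj e.1.1 e.1.2 then W else fun x y => 1 - W x y

theorem eK_K01 {k : ℕ} (F : SimpleGraph (Fin k)) {W : ℝ → ℝ → ℝ} (hW : IsGraphon W) (e : Epr k) :
    K01 (eK F W e) := by
  unfold eK
  split_ifs
  · exact ⟨hW.1, fun x y => hW.2.2 x y⟩
  · refine ⟨measurable_const.sub hW.1, fun x y => ?_⟩
    have := hW.2.2 x y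
    exact ⟨by linarith [this.2], by linarith [this.1]⟩

theorem prod_epr {k : ℕ} (φ : Fin k → Fin k → ℝ) :
    (∏ i, ∏ j, if i < j then φ i j else 1) = ∏ e : Epr k, φ e.1.1 e.1.2 := by
  classical
  rw [← Fintype.prod_prod_type' (f := fun i j => if i < j then φ i j else 1)]
  rw [← Finset.prod_filter (fun p : Fin k × Fin k => p.1 < p.2) (fun p => φ p.1 p.2)]
  exact Finset.prod_subtype _ (by simp) _

theorem indDensity_eq {k : ℕ} (F : SimpleGraph (Fin k)) (W : ℝ → ℝ → ℝ) :
    indDensity F W = ∫ x, ∏ e : Epr k, eK F W e (x e.1.1) (x e.1.2) ∂(piMu k) := by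
  unfold indDensity
  rw [cube_restrict]
  congr 1; ext x
  rw [prod_epr]
  refine Finset.prod_congr rfl fun e _ => ?_
  unfold eK
  split_ifs <;> rfl

theorem counting {k : ℕ} (F : SimpleGraph (Fin k)) {U W : ℝ → ℝ → ℝ} (hU : IsGraphon U)
    (hW : IsGraphon W) :
    |indDensity F W - indDensity F U| ≤
      Fintype.card (Epr k) * (4 * cutNorm fun x y => W x y - U x y) := by
  have := hybrid (eK_K01 F hW) (eK_K01 F hU) (cutNorm fun x y => W x y - U x y) ?_ Finset.univ
  · simpa [indDensity_eq] using this
  · intro e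
    unfold eK
    split_ifs
    · exact le_rfl
    · rw [← cutNorm_neg]
      apply le_of_eq
      congr 1; ext x y; ring

/-- Testability implies the ball condition. -/
theorem forward {R : Set (ℝ → ℝ → ℝ)} (hR : IsGraphonProperty R) (h : GraphonTestable R) :
    ∀ ε : ℝ, 0 < ε → ∃ ε' : ℝ, 0 < ε' ∧ ballCut R ε' ⊆ ball1 R ε := by
  classical
  obtain ⟨R', -, ha, hb⟩ := h
  intro ε hε
  obtain ⟨k, hk1, hk⟩ := hb ε hε
  set N : ℝ := Fintype.card (SimpleGraph (Fin k)) * (Fintype.card (Epr k) * 4) with hN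
  have hN0 : 0 ≤ N := by positivity
  refine ⟨1 / (3 * (N + 1)), by positivity, ?_⟩
  rintro W ⟨hW, hd⟩
  refine ⟨hW, ?_⟩
  by_contra hcon
  have hp := hk k le_rfl W hW (not_lt.1 hcon)
  unfold dCutSetE at hd
  rw [iInf_lt_iff] at hd
  obtain ⟨U, hd⟩ := hd
  rw [iInf_lt_iff] at hd
  obtain ⟨hU, hd⟩ := hd
  rw [ENNReal.ofReal_lt_ofReal_iff (by positivity)] at hd
  have hq := ha U hU k hk1
  have hUg := hR.1 U hU
  set c := cutNorm fun x y => W x y - U x y with hc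
  have hc0 : 0 ≤ c := cutNorm_nonneg (hW.ker.sub hUg.ker)
  have hdiff : probIn k U R' - probIn k W R' ≤ N * c := by
    unfold probIn
    rw [← Finset.sum_sub_distrib]
    calc _ ≤ ∑ F : SimpleGraph (Fin k), (Fintype.card (Epr k) * (4 * c) : ℝ) := by
          refine Finset.sum_le_sum fun F _ => ?_
          have h := counting F hUg hW
          split_ifs
          · have := (abs_le.1 h).1
            linarith
          · simp; positivity
      _ = N * c := by
          rw [Finset.sum_const, Finset.card_univ, nsmul_eq_mul, hN]; ring
  have : N * c < 1 / 3 := by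
    rw [lt_div_iff₀ (by positivity)] at hd
    nlinarith
  linarith

/-! ### Measure preserving transport -/

/-- Distribution function of a set. -/
def cdfS (A : Set ℝ) (x : ℝ) : ℝ := mu.real (A ∩ Set.Iic x)

theorem cdfS_mono (A : Set ℝ) : Monotone (cdfS A) := fun x y h =>
  measureReal_mono (Set.inter_subset_inter_right _ (Set.Iic_subset_Iic.2 h))

theorem mu_Iic {x : ℝ} (hx : x ≤ 0) : mu (Set.Iic x) = 0 := by
  rw [mu, Measure.restrict_apply measurableSet_Iic]
  refine measure_mono_null (t := {0}) ?_ (by simp)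
  rintro y ⟨h1, h2⟩
  have h1 : y ≤ x := h1
  have := h2.1
  simp only [Set.mem_singleton_iff]; linarith

theorem cdfS_zero (A : Set ℝ) {x : ℝ} (hx : x ≤ 0) : cdfS A x = 0 := by
  unfold cdfS
  rw [measureReal_def, measure_mono_null Set.inter_subset_right (mu_Iic hx)]; rfl

theorem cdfS_nonneg (A : Set ℝ) (x : ℝ) : 0 ≤ cdfS A x := measureReal_nonneg

theorem cdfS_le (A : Set ℝ) (x : ℝ) : cdfS A x ≤ mu.real A := measureReal_mono Set.inter_subset_left

theorem cdfS_one (A : Set ℝ) {x : ℝ} (hx : 1 ≤ x) : cdfS A x = mu.real A := by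
  refine le_antisymm (cdfS_le A x) ?_
  unfold cdfS
  have h0 : mu.real (Set.Ioi x) = 0 := by
    rw [measureReal_def, mu, Measure.restrict_apply measurableSet_Ioi]
    have : Set.Ioi x ∩ I01 = ∅ := by
      ext y
      simp only [I01, Set.mem_inter_iff, Set.mem_Ioi, Set.mem_Icc, Set.mem_empty_iff_false,
        iff_false]
      rintro ⟨h1, h2, h3⟩; linarith
    simp [this]
  calc mu.real A ≤ mu.real ((A ∩ Set.Iic x) ∪ Set.Ioi x) := by
        refine measureReal_mono fun y hy => ?_
        rcases le_or_gt y x with h | h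
        · exact Or.inl ⟨hy, h⟩
        · exact Or.inr h
    _ ≤ mu.real (A ∩ Set.Iic x) + mu.real (Set.Ioi x) := measureReal_union_le _ _
    _ = _ := by rw [h0, add_zero]

theorem cdfS_lip (A : Set ℝ) {x y : ℝ} (h : x ≤ y) : cdfS A y ≤ cdfS A x + (y - x) := by
  unfold cdfS
  calc mu.real (A ∩ Set.Iic y) ≤ mu.real ((A ∩ Set.Iic x) ∪ Set.Ioc x y) := by
        refine measureReal_mono fun z hz => ?_
        rcases le_or_gt z x with h | h
        · exact Or.inl ⟨hz.1, h⟩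
        · exact Or.inr ⟨h, hz.2⟩
    _ ≤ mu.real (A ∩ Set.Iic x) + mu.real (Set.Ioc x y) := measureReal_union_le _ _
    _ ≤ _ := by
        gcongr
        have : mu.real (Set.Ioc x y) ≤ volume.real (Set.Ioc x y) := by
          rw [measureReal_def, measureReal_def]
          exact ENNReal.toReal_mono (by simp) (Measure.restrict_le_self _)
        rwa [Real.volume_real_Ioc_of_le h] at this

theorem cdfS_cont (A : Set ℝ) : Continuous (cdfS A) := by
  have : LipschitzWith 1 (cdfS A) := by
    refine LipschitzWith.of_le_add fun x y => ?_
    rcases le_total x y with h | h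
    · have := cdfS_mono A h
      have := dist_nonneg (x := x) (y := y)
      linarith
    · have := cdfS_lip A h
      rw [Real.dist_eq, abs_of_nonneg (by linarith)]; linarith
  exact this.continuous

theorem cdfS_level (A : Set ℝ) {t : ℝ} (h0 : 0 ≤ t) (h1 : t ≤ mu.real A) :
    mu.real (A ∩ {x | cdfS A x ≤ t}) = t := by
  rcases h1.eq_or_lt with h | h
  · have : A ∩ {x | cdfS A x ≤ t} = A := by
      refine Set.inter_eq_left.2 fun x _ => ?_
      show cdfS A x ≤ t
      rw [h]; exact cdfS_le A x
    rw [this, h]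
  · set s : Set ℝ := {x | cdfS A x ≤ t} with hs
    have hcl : IsClosed s := isClosed_le (cdfS_cont A) continuous_const
    have hne : s.Nonempty := ⟨0, by show cdfS A 0 ≤ t; rw [cdfS_zero A le_rfl]; exact h0⟩
    have hbd : BddAbove s := by
      refine ⟨1, fun x hx => ?_⟩
      by_contra hx1
      have hx : cdfS A x ≤ t := hx
      rw [cdfS_one A (not_le.1 hx1).le] at hx
      linarith
    have hmem : sSup s ∈ s := hcl.csSup_mem hne hbd
    have hseq : s = Set.Iic (sSup s) := by
      ext x
      refine ⟨fun hx => le_csSup hbd hx, fun hx => ?_⟩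
      exact (cdfS_mono A hx).trans hmem
    obtain ⟨x0, -, hx0⟩ : t ∈ cdfS A '' Set.Icc 0 1 := by
      refine intermediate_value_Icc zero_le_one (cdfS_cont A).continuousOn ?_
      rw [cdfS_zero A le_rfl, cdfS_one A le_rfl]
      exact ⟨h0, h1⟩
    have hx0s : x0 ≤ sSup s := le_csSup hbd hx0.le
    have : cdfS A (sSup s) = t := le_antisymm hmem (hx0 ▸ cdfS_mono A hx0s)
    rw [hseq]; exact this

/-- Quantile function of a set. -/
def quant (B : Set ℝ) (t : ℝ) : ℝ := sInf {y | t ≤ cdfS B y}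

theorem quant_le_iff (B : Set ℝ) {t : ℝ} (h0 : 0 < t) (h1 : t ≤ mu.real B) (y : ℝ) :
    quant B t ≤ y ↔ t ≤ cdfS B y := by
  set s : Set ℝ := {y | t ≤ cdfS B y} with hs
  have hcl : IsClosed s := isClosed_le continuous_const (cdfS_cont B)
  have hne : s.Nonempty := ⟨1, by show t ≤ cdfS B 1; rw [cdfS_one B le_rfl]; exact h1⟩
  have hbd : BddBelow s := by
    refine ⟨0, fun x hx => ?_⟩
    by_contra hx1
    have hx : t ≤ cdfS B x := hx
    rw [cdfS_zero B (not_le.1 hx1).le] at hx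
    linarith
  have hmem : sInf s ∈ s := hcl.csInf_mem hne hbd
  refine ⟨fun h => ?_, fun h => csInf_le hbd h⟩
  exact le_trans hmem (cdfS_mono B h)

theorem quant_nonneg (B : Set ℝ) {t : ℝ} (h0 : 0 < t) : 0 ≤ quant B t := by
  refine Real.sInf_nonneg fun x hx => ?_
  by_contra hx1
  have hx : t ≤ cdfS B x := hx
  rw [cdfS_zero B (not_le.1 hx1).le] at hx
  linarith

theorem quant_zero (B : Set ℝ) : quant B 0 = 0 := by
  unfold quant
  have : {y | 0 ≤ cdfS B y} = Set.univ := by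
    ext y; simpa using cdfS_nonneg B y
  rw [this, Real.sInf_univ]

theorem transport_sets {A B : Set ℝ} (hA : MeasurableSet A) (hB : MeasurableSet B)
    (h : mu.real A = mu.real B) :
    ∃ χ : ℝ → ℝ, Measurable χ ∧ (mu.restrict A).map χ = mu.restrict B := by
  have hpos : ∀ {x}, ¬ 0 < cdfS A x → cdfS A x = 0 := fun hx =>
    le_antisymm (not_lt.1 hx) (cdfS_nonneg A _)
  have gal : ∀ {x}, 0 < cdfS A x → ∀ y, quant B (cdfS A x) ≤ y ↔ cdfS A x ≤ cdfS B y :=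
    fun hx y => quant_le_iff B hx (h ▸ cdfS_le A _) y
  have hmono : Monotone fun x => quant B (cdfS A x) := by
    intro x x' hxx
    show quant B (cdfS A x) ≤ quant B (cdfS A x')
    by_cases hx : 0 < cdfS A x
    · have hx' := hx.trans_le (cdfS_mono A hxx)
      rw [gal hx]
      exact (cdfS_mono A hxx).trans ((gal hx' _).1 le_rfl)
    · rw [hpos hx, quant_zero]
      by_cases hx' : 0 < cdfS A x'
      · exact quant_nonneg B hx'
      · rw [hpos hx', quant_zero]
  refine ⟨_, hmono.measurable, ?_⟩
  refine Measure.ext_of_Iic _ _ fun y => ?_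
  rw [Measure.map_apply hmono.measurable measurableSet_Iic,
    Measure.restrict_apply (hmono.measurable measurableSet_Iic),
    Measure.restrict_apply measurableSet_Iic]
  have hz : mu (A ∩ {x | cdfS A x ≤ 0}) = 0 := by
    have := cdfS_level A le_rfl measureReal_nonneg
    rwa [measureReal_eq_zero_iff] at this
  have e1 : mu ((fun x => quant B (cdfS A x)) ⁻¹' Set.Iic y ∩ A) =
      mu (A ∩ {x | cdfS A x ≤ cdfS B y}) := by
    refine measure_congr ?_
    have hz' : ∀ᵐ x ∂mu, ¬ (x ∈ A ∩ {x | cdfS A x ≤ 0}) :=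
      measure_eq_zero_iff_ae_notMem.1 hz
    rw [Filter.eventuallyEq_set]
    filter_upwards [hz'] with x hx
    constructor
    · rintro ⟨h1, h2⟩
      refine ⟨h2, ?_⟩
      have hp : 0 < cdfS A x := by
        by_contra hc; exact hx ⟨h2, not_lt.1 hc⟩
      exact (gal hp y).1 h1
    · rintro ⟨h2, h1⟩
      refine ⟨?_, h2⟩
      have hp : 0 < cdfS A x := by
        by_contra hc; exact hx ⟨h2, not_lt.1 hc⟩
      exact (gal hp y).2 h1
  rw [e1, Set.inter_comm (Set.Iic y) B]
  have e2 := cdfS_level A (cdfS_nonneg B y) (h ▸ cdfS_le B y)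
  have e3 : mu.real (A ∩ {x | cdfS A x ≤ cdfS B y}) = mu.real (B ∩ Set.Iic y) := e2
  rw [measureReal_def, measureReal_def] at e3
  exact (ENNReal.toReal_eq_toReal_iff' (measure_ne_top _ _) (measure_ne_top _ _)).1 e3

theorem transport {ι : Type*} [Fintype ι] [MeasurableSpace ι] [MeasurableSingletonClass ι]
    {p p' : ℝ → ι} (hp : Measurable p) (hp' : Measurable p')
    (h : ∀ i, mu.real (p ⁻¹' {i}) = mu.real (p' ⁻¹' {i})) :
    ∃ χ : ℝ → ℝ, MeasurePreserving χ mu mu ∧ ∀ᵐ x ∂mu, p (χ x) = p' x := by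
  classical
  have hm : ∀ i, MeasurableSet (p ⁻¹' {i}) := fun i => hp (measurableSet_singleton i)
  have hm' : ∀ i, MeasurableSet (p' ⁻¹' {i}) := fun i => hp' (measurableSet_singleton i)
  choose c hc hcm using fun i => transport_sets (hm' i) (hm i) (h i).symm
  set χ : ℝ → ℝ := fun x => c (p' x) x with hχ
  have hχm : Measurable χ := by
    have : Measurable fun z : ι × ℝ => c z.1 z.2 := measurable_from_prod_countable_right hc
    exact this.comp (hp'.prodMk measurable_id)
  have hsum : ∀ (r : ℝ → ι), Measurable r → ∀ s, MeasurableSet s →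
      mu s = ∑ i, mu (r ⁻¹' {i} ∩ s) := by
    intro r hr s hs
    have := sum_measure_preimage_singleton (μ := mu.restrict s) (f := r) Finset.univ
      (fun y _ => hr (measurableSet_singleton y))
    simp only [Finset.coe_univ, Set.preimage_univ, Measure.restrict_apply MeasurableSet.univ,
      Set.univ_inter] at this
    rw [← this]
    exact Finset.sum_congr rfl fun i _ => Measure.restrict_apply (hr (measurableSet_singleton i))
  have hpc : ∀ i s, MeasurableSet s → mu (p' ⁻¹' {i} ∩ c i ⁻¹' s) = mu (p ⁻¹' {i} ∩ s) := by
    intro i s hs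
    have := congrArg (fun ν : Measure ℝ => ν s) (hcm i)
    simp only [Measure.map_apply (hc i) hs, Measure.restrict_apply (hc i hs),
      Measure.restrict_apply hs] at this
    rw [Set.inter_comm, this, Set.inter_comm]
  refine ⟨χ, ⟨hχm, ?_⟩, ?_⟩
  · ext s hs
    rw [Measure.map_apply hχm hs, hsum p' hp' _ (hχm hs), hsum p hp s hs]
    refine Finset.sum_congr rfl fun i _ => ?_
    rw [← hpc i s hs]
    congr 1; ext x
    simp only [Set.mem_inter_iff, Set.mem_preimage, Set.mem_singleton_iff, hχ]
    constructor
    · rintro ⟨h1, h2⟩; exact ⟨h1, h1 ▸ h2⟩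
    · rintro ⟨h1, h2⟩; refine ⟨h1, ?_⟩; rw [h1]; exact h2
  · rw [ae_iff]
    have hbad : MeasurableSet {x | ¬ p (χ x) = p' x} :=
      (measurableSet_eq_fun (hp.comp hχm) hp').compl
    rw [hsum p' hp' _ hbad]
    refine Finset.sum_eq_zero fun i _ => ?_
    refine measure_mono_null (t := p' ⁻¹' {i} ∩ c i ⁻¹' (p ⁻¹' {i})ᶜ) ?_ ?_
    · rintro x ⟨h1, h2⟩
      refine ⟨h1, ?_⟩
      have h1 : p' x = i := h1
      have h2 : ¬ p (χ x) = p' x := h2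
      simp only [hχ, h1] at h2
      exact h2
    · rw [hpc i _ (hm i).compl]; simp

theorem transport_approx {ι : Type*} [Fintype ι] [MeasurableSpace ι] [MeasurableSingletonClass ι]
    {p p' : ℝ → ι} (hp : Measurable p) (hp' : Measurable p') :
    ∃ χ : ℝ → ℝ, MeasurePreserving χ mu mu ∧
      mu.real {x | p (χ x) ≠ p' x} ≤
        ∑ i, |mu.real (p ⁻¹' {i}) - mu.real (p' ⁻¹' {i})| := by
  classical
  let _ : MeasurableSpace (Option ι) := ⊤
  have : MeasurableSingletonClass (Option ι) := ⟨fun _ => trivial⟩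
  set m : ι → ℝ := fun i => min (mu.real (p ⁻¹' {i})) (mu.real (p' ⁻¹' {i})) with hmdef
  have key : ∀ q : ℝ → ι, Measurable q → (∀ i, m i ≤ mu.real (q ⁻¹' {i})) →
      ∃ r : ℝ → Option ι, Measurable r ∧ (∀ i, mu.real (r ⁻¹' {some i}) = m i) ∧
        mu.real (r ⁻¹' {none}) = 1 - ∑ i, m i ∧ ∀ x i, r x = some i → q x = i := by
    intro q hq hle
    set B : ι → Set ℝ := fun i => q ⁻¹' {i} ∩ {x | cdfS (q ⁻¹' {i}) x ≤ m i} with hBdef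
    have hBm : ∀ i, MeasurableSet (B i) := fun i =>
      (hq (measurableSet_singleton i)).inter
        (measurableSet_le (cdfS_cont _).measurable measurable_const)
    have hBv : ∀ i, mu.real (B i) = m i := fun i =>
      cdfS_level _ (le_min measureReal_nonneg measureReal_nonneg) (hle i)
    set r : ℝ → Option ι := fun x => if x ∈ B (q x) then some (q x) else none with hr
    have hrs : ∀ i, r ⁻¹' {some i} = B i := by
      intro i; ext x
      simp only [Set.mem_preimage, Set.mem_singleton_iff, hr]
      constructor
      · intro h
        split_ifs at h with h1
        have : q x = i := by simpa using h
        rwa [this] at h1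
      · intro h
        have : q x = i := h.1
        rw [this, if_pos h]
    have hrn : r ⁻¹' {none} = (⋃ i, B i)ᶜ := by
      ext x
      simp only [Set.mem_preimage, Set.mem_singleton_iff, hr, Set.mem_compl_iff, Set.mem_iUnion]
      constructor
      · intro h
        split_ifs at h with h1
        rintro ⟨i, hi⟩
        have : q x = i := hi.1
        rw [this] at h1; exact h1 hi
      · intro h
        rw [if_neg fun h1 => h ⟨_, h1⟩]
    refine ⟨r, ?_, fun i => by rw [hrs, hBv], ?_, ?_⟩
    · refine measurable_to_countable' fun y => ?_
      cases y with
      | none => rw [hrn]; exact (MeasurableSet.iUnion hBm).compl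
      | some i => rw [hrs]; exact hBm i
    · rw [hrn, probReal_compl_eq_one_sub (MeasurableSet.iUnion hBm)]
      congr 1
      rw [measureReal_iUnion_fintype _ hBm]
      · exact Finset.sum_congr rfl fun i _ => hBv i
      · intro i j hij
        refine Set.disjoint_left.2 fun x hx hx' => hij ?_
        exact (show q x = i from hx.1).symm.trans hx'.1
    · intro x i h
      simp only [hr] at h
      split_ifs at h
      simpa using h
  obtain ⟨r, hrm, hr1, hr2, hr3⟩ := key p hp fun i => min_le_left _ _
  obtain ⟨r', hrm', hr1', hr2', hr3'⟩ := key p' hp' fun i => min_le_right _ _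
  obtain ⟨χ, hχ, hae⟩ := transport hrm hrm' (by
    intro i
    cases i with
    | none => rw [hr2, hr2']
    | some i => rw [hr1, hr1'])
  refine ⟨χ, hχ, ?_⟩
  have h1 : mu.real {x | p (χ x) ≠ p' x} ≤ mu.real (r' ⁻¹' {none}) := by
    rw [measureReal_def, measureReal_def]
    refine ENNReal.toReal_mono (measure_ne_top _ _) (measure_mono_ae ?_)
    filter_upwards [hae] with x hx
    intro hne
    show r' x = none
    by_contra hc
    obtain ⟨i, hi⟩ := Option.ne_none_iff_exists'.1 hc
    exact hne ((hr3 _ i (hx.trans hi)).trans (hr3' x i hi).symm)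
  refine h1.trans ?_
  rw [hr2']
  have htot : ∑ i, mu.real (p' ⁻¹' {i}) = 1 := by
    rw [sum_measureReal_preimage_singleton _ (fun y _ => hp' (measurableSet_singleton y))]
    simp
  rw [← htot, ← Finset.sum_sub_distrib]
  refine Finset.sum_le_sum fun i _ => ?_
  simp only [hmdef]
  rcases le_total (mu.real (p ⁻¹' {i})) (mu.real (p' ⁻¹' {i})) with h | h
  · rw [min_eq_left h, abs_sub_comm]; exact le_abs_self _
  · rw [min_eq_right h, sub_self]; exact abs_nonneg _

/-! ### Weak regularity -/

theorem cutNorm_le_sets {D : ℝ → ℝ → ℝ} {c : ℝ}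
    (h : ∀ S T, MeasurableSet S → MeasurableSet T →
      |cutF D (S.indicator 1) (T.indicator 1)| ≤ c) : cutNorm D ≤ c := by
  refine csSup_le ⟨_, ∅, ∅, MeasurableSet.empty, MeasurableSet.empty, by simp, by simp, rfl⟩ ?_
  rintro r ⟨S, T, hS, hT, hS1, hT1, rfl⟩
  have := h _ _ hS hT
  rwa [cutF_ind D hS hT, restr_sub hS, restr_sub hT, Set.inter_eq_left.2 hS1,
    Set.inter_eq_left.2 hT1] at this

/-- The squared `L²` norm. -/
def energy (D : ℝ → ℝ → ℝ) : ℝ := ∫ z, (D z.1 z.2) ^ 2 ∂(mu.prod mu)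

theorem step_ker {ι : Type*} [Finite ι] [MeasurableSpace ι] [MeasurableSingletonClass ι]
    {W : ℝ → ℝ → ℝ} (hW : IsGraphon W) {q : ℝ → ι} (hq : Measurable q) {h : ι → ι → ℝ}
    (hh : ∀ a b, 0 ≤ h a b ∧ h a b ≤ 1) :
    Measurable (Function.uncurry fun x y => W x y - h (q x) (q y)) ∧
      ∀ x y, |W x y - h (q x) (q y)| ≤ 1 := by
  have hm : Measurable (Function.uncurry h) := measurable_of_finite _
  constructor
  · exact hW.1.sub (hm.comp ((hq.comp measurable_fst).prodMk (hq.comp measurable_snd)))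
  · intro x y
    have := hW.2.2 x y
    have := hh (q x) (q y)
    rw [abs_le]; constructor <;> linarith [(hW.2.2 x y).1, (hW.2.2 x y).2]

theorem clamp_sq {w z : ℝ} (h0 : 0 ≤ w) (h1 : w ≤ 1) :
    (w - max 0 (min 1 z)) ^ 2 ≤ (w - z) ^ 2 := by
  rcases le_total z 0 with h | h
  · rw [min_eq_right (by linarith), max_eq_left h]; nlinarith
  · rcases le_total z 1 with h' | h'
    · rw [min_eq_right h', max_eq_right h]
    · rw [min_eq_left h', max_eq_right zero_le_one]; nlinarith

theorem reg_step {n : ℕ} {W : ℝ → ℝ → ℝ} (hW : IsGraphon W) {q : ℝ → Fin (4 ^ n)}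
    (hq : Measurable q) {h : Fin (4 ^ n) → Fin (4 ^ n) → ℝ}
    (hh : ∀ a b, 0 ≤ h a b ∧ h a b ≤ 1) {η : ℝ} (hη : 0 < η)
    (hcut : η < cutNorm fun x y => W x y - h (q x) (q y)) :
    ∃ (q' : ℝ → Fin (4 ^ (n + 1))) (h' : Fin (4 ^ (n + 1)) → Fin (4 ^ (n + 1)) → ℝ),
      Measurable q' ∧ (∀ a b, 0 ≤ h' a b ∧ h' a b ≤ 1) ∧
      energy (fun x y => W x y - h' (q' x) (q' y)) ≤
        energy (fun x y => W x y - h (q x) (q y)) - η ^ 2 := by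
  classical
  set D : ℝ → ℝ → ℝ := fun x y => W x y - h (q x) (q y) with hDdef
  have hD := step_ker hW hq hh
  have hDk : Ker D := ⟨hD.1, 1, hD.2⟩
  obtain ⟨S, T, hS, hT, hc⟩ : ∃ S T, MeasurableSet S ∧ MeasurableSet T ∧
      η < |cutF D (S.indicator 1) (T.indicator 1)| := by
    by_contra hcon
    push Not at hcon
    exact absurd (cutNorm_le_sets hcon) (not_le.2 hcut)
  set c := cutF D (S.indicator 1) (T.indicator 1) with hcdef
  let eqv : Fin (4 ^ n) × Bool × Bool ≃ Fin (4 ^ (n + 1)) :=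
    Fintype.equivFinOfCardEq (by simp [pow_succ])
  set Q : ℝ → Fin (4 ^ n) × Bool × Bool := fun x => (q x, decide (x ∈ S), decide (x ∈ T)) with hQ
  have hind : ∀ S : Set ℝ, MeasurableSet S → Measurable fun x => decide (x ∈ S) := by
    intro S hS
    refine measurable_to_bool ?_
    convert hS using 1
    ext x; simp
  have hQm : Measurable Q := hq.prodMk ((hind S hS).prodMk (hind T hT))
  let H : Fin (4 ^ n) × Bool × Bool → Fin (4 ^ n) × Bool × Bool → ℝ := fun a b =>
    max 0 (min 1 (h a.1 b.1 + if a.2.1 = true ∧ b.2.2 = true then c else 0))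
  have hH : ∀ a b, 0 ≤ H a b ∧ H a b ≤ 1 := fun a b =>
    ⟨le_max_left _ _, max_le zero_le_one (min_le_left _ _)⟩
  refine ⟨fun x => eqv (Q x), fun a b => H (eqv.symm a) (eqv.symm b),
    (measurable_of_finite eqv).comp hQm, fun a b => hH _ _, ?_⟩
  simp only [Equiv.symm_apply_apply]
  have hD' := step_ker hW hQm hH
  set f : ℝ → ℝ := S.indicator 1 with hf
  set g : ℝ → ℝ := T.indicator 1 with hg
  have wf : Wt f := Wt.ind hS
  have wg : Wt g := Wt.ind hT
  have kfg := hDk.mul_wt wf wg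
  have i1 : Integrable (fun z : ℝ × ℝ => (D z.1 z.2) ^ 2) (mu.prod mu) :=
    int_bd (hD.1.pow_const 2) 1 fun z => by
      rw [abs_of_nonneg (sq_nonneg _), sq_le_one_iff_abs_le_one]; exact hD.2 _ _
  have i2 : Integrable (fun z : ℝ × ℝ => f z.1 * g z.2 * D z.1 z.2) (mu.prod mu) := kfg.integrable
  have i3 : Integrable (fun z : ℝ × ℝ => f z.1 * g z.2 ) (mu.prod mu) := by
    refine int_bd ((wf.1.comp measurable_fst).mul (wg.1.comp measurable_snd)) 1 fun z => ?_
    have h1 := wf.2 z.1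
    have h2 := wg.2 z.2
    rw [abs_of_nonneg (mul_nonneg h1.1 h2.1)]; nlinarith
  have i0 : Integrable (fun z : ℝ × ℝ => (W z.1 z.2 - H (Q z.1) (Q z.2)) ^ 2) (mu.prod mu) :=
    int_bd (hD'.1.pow_const 2) 1 fun z => by
      rw [abs_of_nonneg (sq_nonneg _), sq_le_one_iff_abs_le_one]; exact hD'.2 _ _
  have hcint : c = ∫ z, f z.1 * g z.2 * D z.1 z.2 ∂(mu.prod mu) := by
    rw [hcdef]; unfold cutF
    rw [integral_integral kfg.integrable]
  have hm1 : ∫ z, f z.1 * g z.2 ∂(mu.prod mu) ≤ 1 := by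
    have := integral_mono i3 (integrable_const (μ := mu.prod mu) (1 : ℝ)) (fun z => by
      have h1 := wf.2 z.1
      have h2 := wg.2 z.2
      show f z.1 * g z.2 ≤ 1
      nlinarith)
    simpa using this
  have hle : energy (fun x y => W x y - H (Q x) (Q y)) ≤
      ∫ z, ((D z.1 z.2) ^ 2 - 2 * c * (f z.1 * g z.2 * D z.1 z.2) + c ^ 2 * (f z.1 * g z.2))
        ∂(mu.prod mu) := by
    unfold energy
    refine integral_mono i0 ((i1.sub (i2.const_mul (2 * c))).add (i3.const_mul (c ^ 2)))
      fun z => ?_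
    have hw := hW.2.2 z.1 z.2
    refine (clamp_sq hw.1 hw.2).trans ?_
    by_cases h1 : z.1 ∈ S <;> by_cases h2 : z.2 ∈ T <;>
      simp only [hQ, hf, hg, hDdef, h1, h2, Set.indicator, Pi.one_apply, decide_true, decide_false,
        if_true, if_false, and_self, and_true, and_false, Bool.false_eq_true] <;>
      nlinarith
  have i12 : Integrable (fun z : ℝ × ℝ => (D z.1 z.2) ^ 2 - 2 * c * (f z.1 * g z.2 * D z.1 z.2))
      (mu.prod mu) := i1.sub (i2.const_mul (2 * c))
  rw [integral_add i12 (i3.const_mul (c ^ 2)),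
    integral_sub i1 (i2.const_mul (2 * c)), integral_const_mul, integral_const_mul, ← hcint] at hle
  have hsq : η ^ 2 ≤ c ^ 2 := by
    rw [← sq_abs c]; exact pow_le_pow_left₀ hη.le hc.le 2
  have : energy D = ∫ z, (D z.1 z.2) ^ 2 ∂(mu.prod mu) := rfl
  nlinarith [sq_nonneg c]

theorem regularity (η : ℝ) (hη : 0 < η) : ∃ N : ℕ, ∀ W, IsGraphon W → ∃ n ≤ N,
    ∃ (q : ℝ → Fin (4 ^ n)) (h : Fin (4 ^ n) → Fin (4 ^ n) → ℝ),
      Measurable q ∧ (∀ a b, 0 ≤ h a b ∧ h a b ≤ 1) ∧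
      cutNorm (fun x y => W x y - h (q x) (q y)) ≤ η := by
  obtain ⟨N, hN⟩ := exists_nat_gt (1 / η ^ 2)
  refine ⟨N, fun W hW => ?_⟩
  by_contra hcon
  push Not at hcon
  have key : ∀ n ≤ N, ∃ (q : ℝ → Fin (4 ^ n)) (h : Fin (4 ^ n) → Fin (4 ^ n) → ℝ),
      Measurable q ∧ (∀ a b, 0 ≤ h a b ∧ h a b ≤ 1) ∧
      energy (fun x y => W x y - h (q x) (q y)) ≤ 1 - n * η ^ 2 := by
    intro n
    induction n with
    | zero =>
      intro _
      refine ⟨fun _ => ⟨0, by norm_num⟩, fun _ _ => 0, measurable_const, fun _ _ => by norm_num, ?_⟩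
      unfold energy
      have := abs_int_le (ν := mu.prod mu) (f := fun z : ℝ × ℝ => (W z.1 z.2 - 0) ^ 2) 1 fun z => by
        have := hW.2.2 z.1 z.2
        rw [abs_of_nonneg (sq_nonneg _)]; nlinarith [this.1, this.2]
      simpa using (le_abs_self _).trans this
    | succ n ih =>
      intro hn
      obtain ⟨q, h, hq, hh, he⟩ := ih (by omega)
      obtain ⟨q', h', hq', hh', he'⟩ := reg_step hW hq hh hη (hcon n (by omega) q h hq hh)
      refine ⟨q', h', hq', hh', he'.trans ?_⟩
      push_cast; linarith
  obtain ⟨q, h, hq, hh, he⟩ := key N le_rfl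
  have h0 : 0 ≤ energy (fun x y => W x y - h (q x) (q y)) := integral_nonneg fun z => sq_nonneg _
  rw [div_lt_iff₀ (by positivity)] at hN
  linarith

/-! ### Sums over graphs -/

/-- Graphs on `Fin k` as 0-1 labellings of the pairs. -/
def graphEquiv (k : ℕ) : SimpleGraph (Fin k) ≃ (Epr k → Bool) := by
  classical
  exact
  { toFun := fun F e => decide (F.Adj e.1.1 e.1.2)
    invFun := fun b => SimpleGraph.fromRel fun i j => ∃ h : i < j, b ⟨(i, j), h⟩ = true
    left_inv := by
      intro F
      ext i j
      simp only [SimpleGraph.fromRel_adj, decide_eq_true_eq, exists_prop]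
      constructor
      · rintro ⟨_, ⟨_, h⟩ | ⟨_, h⟩⟩
        · exact h
        · exact h.symm
      · intro h
        refine ⟨h.ne, ?_⟩
        rcases lt_or_gt_of_ne h.ne with h' | h'
        · exact Or.inl ⟨h', h⟩
        · exact Or.inr ⟨h', h.symm⟩
    right_inv := by
      intro b
      funext ⟨⟨i, j⟩, h⟩
      have h : i < j := h
      have : ¬ j < i := not_lt.2 h.le
      by_cases hb : b ⟨(i, j), h⟩ = true
      · simp [SimpleGraph.fromRel_adj, h.ne, h, hb]
      · have hb' : b ⟨(i, j), h⟩ = false := by simpa using hb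
        simp [SimpleGraph.fromRel_adj, this, hb'] }

theorem graphEquiv_apply {k : ℕ} (F : SimpleGraph (Fin k)) (e : Epr k) :
    graphEquiv k F e = true ↔ F.Adj e.1.1 e.1.2 := by
  simp [graphEquiv]

theorem graph_sum {k : ℕ} (φ : Epr k → Bool → ℝ) :
    ∑ F : SimpleGraph (Fin k), ∏ e, φ e (graphEquiv k F e) = ∏ e, (φ e true + φ e false) := by
  classical
  rw [Equiv.sum_comp (graphEquiv k) (fun b => ∏ e, φ e (b e))]
  have h2 : ∀ e, φ e true + φ e false = ∑ b : Bool, φ e b := fun e => by simp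
  simp only [h2]
  rw [Finset.prod_univ_sum, Fintype.piFinset_univ]

open Classical in
/-- Conditional probability of the graph `F` given edge probabilities `U`. -/
def wgt {k : ℕ} (U : Fin k → Fin k → ℝ) (F : SimpleGraph (Fin k)) : ℝ :=
  ∏ e : Epr k, if F.Adj e.1.1 e.1.2 then U e.1.1 e.1.2 else 1 - U e.1.1 e.1.2

open Classical in
/-- Difference of the adjacency matrix and `H`. -/
def adf {k : ℕ} (H : Fin k → Fin k → ℝ) (F : SimpleGraph (Fin k)) (i j : Fin k) : ℝ :=
  (if F.Adj i j then 1 else 0) - H i j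

theorem graph_sum_t {k : ℕ} {T : Type*} [Fintype T] (U : Fin k → Fin k → ℝ) (e : T → Epr k)
    (he : Function.Injective e) (f : T → Bool → ℝ) :
    ∑ F : SimpleGraph (Fin k), wgt U F * ∏ t, f t (graphEquiv k F (e t)) =
      ∏ t, (U (e t).1.1 (e t).1.2 * f t true + (1 - U (e t).1.1 (e t).1.2) * f t false) := by
  classical
  let w : Epr k → Bool → ℝ := fun e b => if b = true then U e.1.1 e.1.2 else 1 - U e.1.1 e.1.2
  have h1 : ∀ F : SimpleGraph (Fin k), wgt U F * ∏ t, f t (graphEquiv k F (e t)) =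
      ∏ d, (w d (graphEquiv k F d) * ∏ t with e t = d, f t (graphEquiv k F d)) := by
    intro F
    rw [Finset.prod_mul_distrib]
    congr 1
    · unfold wgt
      refine Finset.prod_congr rfl fun d _ => ?_
      simp only [w, graphEquiv_apply]
    · rw [← Finset.prod_fiberwise (s := Finset.univ) (g := e)]
      refine Finset.prod_congr rfl fun d _ => Finset.prod_congr rfl fun t ht => ?_
      rw [(Finset.mem_filter.1 ht).2]
  simp only [h1]
  rw [graph_sum (fun d b => w d b * ∏ t with e t = d, f t b)]
  rw [← Finset.prod_subset (Finset.subset_univ (Finset.univ.image e))]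
  · rw [Finset.prod_image fun a _ b _ h => he h]
    refine Finset.prod_congr rfl fun t _ => ?_
    have : (Finset.univ.filter fun t' => e t' = e t) = {t} := by
      ext t'; simp [he.eq_iff]
    simp [this, w]
  · intro d _ hd
    have : (Finset.univ.filter fun t' => e t' = d) = ∅ := by
      ext t'
      simp only [Finset.mem_filter, Finset.mem_univ, true_and, Finset.notMem_empty, iff_false]
      exact fun h => hd (Finset.mem_image.2 ⟨t', Finset.mem_univ _, h⟩)
    simp [this, w]

theorem wgt_sum {k : ℕ} (U : Fin k → Fin k → ℝ) : ∑ F : SimpleGraph (Fin k), wgt U F = 1 := by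
  have := graph_sum_t U (fun t : Empty => t.elim) (fun t => t.elim) (fun t => t.elim)
  simpa using this

theorem wgt_nonneg {k : ℕ} {U : Fin k → Fin k → ℝ} (hU : ∀ i j, 0 ≤ U i j ∧ U i j ≤ 1)
    (F : SimpleGraph (Fin k)) : 0 ≤ wgt U F := by
  unfold wgt
  refine Finset.prod_nonneg fun e _ => ?_
  have := hU e.1.1 e.1.2
  split_ifs <;> linarith

/-- The unordered pair as an element of `Epr`. -/
def ep {k : ℕ} {i j : Fin k} (h : i ≠ j) : Epr k :=
  if h' : i < j then ⟨(i, j), h'⟩ else ⟨(j, i), lt_of_le_of_ne (not_lt.1 h') h.symm⟩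

theorem ep_cases {k : ℕ} {i j : Fin k} (h : i ≠ j) :
    (ep h).1 = (i, j) ∨ (ep h).1 = (j, i) := by
  unfold ep; split_ifs <;> simp

theorem ep_ne {k : ℕ} {i j i' j' : Fin k} (h : i ≠ j) (h' : i' ≠ j')
    (hne : ¬ (i = i' ∧ j = j') ∧ ¬ (i = j' ∧ j = i')) : ep h ≠ ep h' := by
  intro he
  have he : (ep h).1 = (ep h').1 := by rw [he]
  rcases ep_cases h with h1 | h1 <;> rcases ep_cases h' with h2 | h2 <;> rw [h1, h2] at he <;>
    simp only [Prod.mk.injEq] at he <;> tauto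

theorem graph_sum4 {k : ℕ} {U : Fin k → Fin k → ℝ} (hU : ∀ i j, U i j = U j i)
    (H : Fin k → Fin k → ℝ) {i l j m : Fin k} (hil : i ≠ l) (hjm : j ≠ m) (hij : i ≠ j)
    (him : i ≠ m) (hlj : l ≠ j) (hlm : l ≠ m) :
    ∑ F : SimpleGraph (Fin k), wgt U F * (adf H F i j * adf H F i m * adf H F l j * adf H F l m) =
      (U i j - H i j) * (U i m - H i m) * (U l j - H l j) * (U l m - H l m) := by
  classical
  have hinj : Function.Injective ![ep hij, ep him, ep hlj, ep hlm] := by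
    have n1 : ep hij ≠ ep him := ep_ne _ _ (by tauto)
    have n2 : ep hij ≠ ep hlj := ep_ne _ _ (by tauto)
    have n3 : ep hij ≠ ep hlm := ep_ne _ _ (by tauto)
    have n4 : ep him ≠ ep hlj := ep_ne _ _ (by tauto)
    have n5 : ep him ≠ ep hlm := ep_ne _ _ (by tauto)
    have n6 : ep hlj ≠ ep hlm := ep_ne _ _ (by tauto)
    intro a b hab
    fin_cases a <;> fin_cases b <;> simp_all
  have adj : ∀ (F : SimpleGraph (Fin k)) {a b : Fin k} (h : a ≠ b),
      graphEquiv k F (ep h) = true ↔ F.Adj a b := by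
    intro F a b h
    rw [graphEquiv_apply]
    rcases ep_cases h with h1 | h1 <;> rw [h1]
    exact F.adj_comm _ _
  have hUe : ∀ {a b : Fin k} (h : a ≠ b), U (ep h).1.1 (ep h).1.2 = U a b := by
    intro a b h
    rcases ep_cases h with h1 | h1 <;> rw [h1]
    exact hU _ _
  have := graph_sum_t U ![ep hij, ep him, ep hlj, ep hlm] hinj
    (fun t b => (if b = true then (1 : ℝ) else 0) - ![H i j, H i m, H l j, H l m] t)
  simp only [Fin.prod_univ_four, Matrix.cons_val_zero, Matrix.cons_val_one, Matrix.cons_val,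
    adj, hUe] at this
  unfold adf
  refine Eq.trans ?_ (this.trans ?_)
  · refine Finset.sum_congr rfl fun F _ => ?_
    congr
  · simp
    ring

/-! ### The fourth moment and the cut norm of a matrix -/

/-- Normalised trace of the fourth power. -/
def M4 {k : ℕ} (A : Fin k → Fin k → ℝ) : ℝ :=
  (∑ j, ∑ m, (∑ i, A i j * A i m) ^ 2) / (k : ℝ) ^ 4

theorem M4_nonneg {k : ℕ} (A : Fin k → Fin k → ℝ) : 0 ≤ M4 A := by
  unfold M4; positivity

theorem M4_eq {k : ℕ} (A : Fin k → Fin k → ℝ) :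
    M4 A = (∑ j, ∑ m, ∑ i, ∑ l, A i j * A i m * A l j * A l m) / (k : ℝ) ^ 4 := by
  unfold M4
  congr 1
  refine Finset.sum_congr rfl fun j _ => Finset.sum_congr rfl fun m _ => ?_
  rw [sq, Finset.sum_mul_sum]
  refine Finset.sum_congr rfl fun i _ => Finset.sum_congr rfl fun l _ => ?_
  ring

theorem bilin_le {k : ℕ} (hk : 1 ≤ k) (A : Fin k → Fin k → ℝ) {σ τ : Fin k → ℝ}
    (hσ : ∀ i, 0 ≤ σ i ∧ σ i ≤ 1 / k) (hτ : ∀ i, 0 ≤ τ i ∧ τ i ≤ 1 / k) :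
    (∑ i, ∑ j, A i j * σ i * τ j) ^ 4 ≤ M4 A := by
  have hk0 : (0 : ℝ) < k := by exact_mod_cast hk
  have hsq : ∀ {σ : Fin k → ℝ}, (∀ i, 0 ≤ σ i ∧ σ i ≤ 1 / k) → ∑ i, σ i ^ 2 ≤ 1 / k := by
    intro σ hσ
    calc ∑ i, σ i ^ 2 ≤ ∑ i : Fin k, (1 / (k : ℝ)) ^ 2 :=
          Finset.sum_le_sum fun i _ => pow_le_pow_left₀ (hσ i).1 (hσ i).2 2
      _ = 1 / k := by
          simp; field_simp
  have e1 : ∑ i, ∑ j, A i j * σ i * τ j = ∑ i, σ i * ∑ j, A i j * τ j := by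
    refine Finset.sum_congr rfl fun i _ => ?_
    rw [Finset.mul_sum]
    refine Finset.sum_congr rfl fun j _ => ?_
    ring
  have c1 : (∑ i, σ i * ∑ j, A i j * τ j) ^ 2 ≤ (∑ i, σ i ^ 2) * ∑ i, (∑ j, A i j * τ j) ^ 2 :=
    Finset.sum_mul_sq_le_sq_mul_sq _ _ _
  have e2 : ∑ i, (∑ j, A i j * τ j) ^ 2 =
      ∑ z : Fin k × Fin k, (τ z.1 * τ z.2) * ∑ i, A i z.1 * A i z.2 := by
    rw [Fintype.sum_prod_type]
    have : ∀ i, (∑ j, A i j * τ j) ^ 2 = ∑ j, ∑ m, (A i j * τ j) * (A i m * τ m) := fun i => by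
      rw [sq, Finset.sum_mul_sum]
    simp only [this, Finset.mul_sum]
    rw [Finset.sum_comm]
    refine Finset.sum_congr rfl fun j _ => ?_
    rw [Finset.sum_comm]
    refine Finset.sum_congr rfl fun m _ => Finset.sum_congr rfl fun i _ => ?_
    ring
  have c2 : (∑ z : Fin k × Fin k, (τ z.1 * τ z.2) * ∑ i, A i z.1 * A i z.2) ^ 2 ≤
      (∑ z : Fin k × Fin k, (τ z.1 * τ z.2) ^ 2) *
        ∑ z : Fin k × Fin k, (∑ i, A i z.1 * A i z.2) ^ 2 :=
    Finset.sum_mul_sq_le_sq_mul_sq _ _ _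
  have e3 : ∑ z : Fin k × Fin k, (τ z.1 * τ z.2) ^ 2 = (∑ i, τ i ^ 2) * (∑ i, τ i ^ 2) := by
    rw [Fintype.sum_prod_type, Finset.sum_mul_sum]
    simp only [mul_pow]
  have e4 : ∑ z : Fin k × Fin k, (∑ i, A i z.1 * A i z.2) ^ 2 = k ^ 4 * M4 A := by
    rw [Fintype.sum_prod_type]
    unfold M4
    field_simp
  rw [e4, e3, ← e2] at c2
  rw [e1]
  set X := ∑ i, (∑ j, A i j * τ j) ^ 2 with hX
  set Y := ∑ i, σ i * ∑ j, A i j * τ j with hY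
  have hX0 : 0 ≤ X := Finset.sum_nonneg fun i _ => sq_nonneg _
  have hM := M4_nonneg A
  have s1 := hsq hσ
  have s2 := hsq hτ
  have s20 : 0 ≤ ∑ i, τ i ^ 2 := Finset.sum_nonneg fun i _ => sq_nonneg _
  have d1 : Y ^ 2 ≤ 1 / k * X := c1.trans (mul_le_mul_of_nonneg_right s1 hX0)
  have d2 : X ^ 2 ≤ (1 / k * (1 / k)) * (k ^ 4 * M4 A) :=
    c2.trans (mul_le_mul_of_nonneg_right (mul_le_mul s2 s2 s20 (by positivity)) (by positivity))
  calc Y ^ 4 = (Y ^ 2) ^ 2 := by ring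
    _ ≤ (1 / k * X) ^ 2 := pow_le_pow_left₀ (sq_nonneg _) d1 2
    _ = (1 / k) ^ 2 * X ^ 2 := by ring
    _ ≤ (1 / k) ^ 2 * ((1 / k * (1 / k)) * (k ^ 4 * M4 A)) :=
        mul_le_mul_of_nonneg_left d2 (by positivity)
    _ = M4 A := by field_simp

theorem cutNorm_M4 {k : ℕ} (hk : 1 ≤ k) (A : Fin k → Fin k → ℝ) {p : ℝ → Fin k}
    (hp : Measurable p) (hu : ∀ i, mu.real (p ⁻¹' {i}) = 1 / k) {c : ℝ} (hc : 0 ≤ c)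
    (hM : M4 A ≤ c ^ 4) : cutNorm (fun x y => A (p x) (p y)) ≤ c := by
  classical
  refine cutNorm_le fun f g hf hg => ?_
  have hfi : ∀ {f : ℝ → ℝ}, Wt f → ∀ i, Wt ((p ⁻¹' {i}).indicator f) := by
    intro f hf i
    refine ⟨hf.1.indicator (hp (measurableSet_singleton i)), fun x => ?_⟩
    by_cases hx : x ∈ p ⁻¹' {i}
    · rw [Set.indicator_of_mem hx]; exact hf.2 x
    · rw [Set.indicator_of_notMem hx]; norm_num
  have hint : ∀ {f : ℝ → ℝ}, Wt f → Integrable f mu := fun {f} hf => int_bd hf.1 1 fun x => by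
    rw [abs_of_nonneg (hf.2 x).1]; exact (hf.2 x).2
  have hσ : ∀ {f : ℝ → ℝ}, Wt f → ∀ i, 0 ≤ ∫ x, (p ⁻¹' {i}).indicator f x ∂mu ∧
      ∫ x, (p ⁻¹' {i}).indicator f x ∂mu ≤ 1 / k := by
    intro f hf i
    refine ⟨integral_nonneg fun x => ((hfi hf i).2 x).1, ?_⟩
    rw [← hu i, ← integral_indicator_one (hp (measurableSet_singleton i))]
    refine integral_mono (hint (hfi hf i)) (hint (Wt.ind (hp (measurableSet_singleton i)))) ?_
    intro x
    exact Set.indicator_le_indicator (hf.2 x).2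
  have e : cutF (fun x y => A (p x) (p y)) f g =
      ∑ i, ∑ j, A i j * (∫ x, (p ⁻¹' {i}).indicator f x ∂mu) *
        (∫ x, (p ⁻¹' {j}).indicator g x ∂mu) := by
    unfold cutF
    have h1 : ∀ x y, f x * g y * A (p x) (p y) =
        ∑ i, ∑ j, A i j * (p ⁻¹' {i}).indicator f x * (p ⁻¹' {j}).indicator g y := by
      intro x y
      rw [Finset.sum_eq_single (p x), Finset.sum_eq_single (p y)]
      · simp; ring
      · intro j _ hj
        have : y ∉ p ⁻¹' {j} := fun h => hj h.symm
        simp [Set.indicator_of_notMem this]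
      · simp
      · intro i _ hi
        have : x ∉ p ⁻¹' {i} := fun h => hi h.symm
        simp [Set.indicator_of_notMem this]
      · simp
    simp only [h1]
    have h2 : ∀ x, ∫ y, ∑ i, ∑ j, A i j * (p ⁻¹' {i}).indicator f x *
        (p ⁻¹' {j}).indicator g y ∂mu = ∑ i, ∑ j, A i j * (p ⁻¹' {i}).indicator f x *
        ∫ y, (p ⁻¹' {j}).indicator g y ∂mu := by
      intro x
      rw [integral_finsetSum]
      · refine Finset.sum_congr rfl fun i _ => ?_
        rw [integral_finsetSum]
        · refine Finset.sum_congr rfl fun j _ => ?_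
          rw [integral_const_mul]
        · exact fun j _ => (hint (hfi hg j)).const_mul _
      · exact fun i _ => integrable_finsetSum _ fun j _ => (hint (hfi hg j)).const_mul _
    simp only [h2]
    have h3 : ∀ i j, Integrable (fun x => A i j * (p ⁻¹' {i}).indicator f x *
        ∫ y, (p ⁻¹' {j}).indicator g y ∂mu) mu := fun i j =>
      ((hint (hfi hf i)).const_mul _).mul_const _
    rw [integral_finsetSum]
    · refine Finset.sum_congr rfl fun i _ => ?_
      rw [integral_finsetSum]
      · refine Finset.sum_congr rfl fun j _ => ?_
        rw [integral_mul_const, integral_const_mul]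
      · exact fun j _ => h3 i j
    · exact fun i _ => integrable_finsetSum _ fun j _ => h3 i j
  rw [e]
  have := (bilin_le hk A (hσ hf) (hσ hg)).trans hM
  refine le_of_pow_le_pow_left₀ (n := 4) (by norm_num) hc ?_
  rwa [pow_abs, abs_of_nonneg (by positivity)]

/-! ### Expectations over the random graph -/

/-- The edge probabilities given the sample points. -/
abbrev smp {k : ℕ} (W : ℝ → ℝ → ℝ) (x : Fin k → ℝ) : Fin k → Fin k → ℝ :=
  fun i j => W (x i) (x j)

theorem indDensity_wgt {k : ℕ} (F : SimpleGraph (Fin k)) (W : ℝ → ℝ → ℝ) :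
    indDensity F W = ∫ x, wgt (smp W x) F ∂(piMu k) := by
  classical
  rw [indDensity_eq]
  congr 1; ext x
  unfold wgt
  refine Finset.prod_congr rfl fun e _ => ?_
  unfold eK
  split_ifs <;> rfl

theorem wgt_meas {k : ℕ} (F : SimpleGraph (Fin k)) {W : ℝ → ℝ → ℝ} (hW : IsGraphon W) :
    Measurable fun x : Fin k → ℝ => wgt (smp W x) F := by
  classical
  unfold wgt
  refine Finset.measurable_prod _ fun e _ => ?_
  have := hW.ker.meas₂ (measurable_pi_apply (X := fun _ : Fin k => ℝ) e.1.1) (measurable_pi_apply e.1.2)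
  split_ifs
  · exact this
  · exact measurable_const.sub this

theorem smp_bd {k : ℕ} {W : ℝ → ℝ → ℝ} (hW : IsGraphon W) (x : Fin k → ℝ) (i j : Fin k) :
    0 ≤ smp W x i j ∧ smp W x i j ≤ 1 := hW.2.2 _ _

theorem wgt_abs {k : ℕ} (F : SimpleGraph (Fin k)) {W : ℝ → ℝ → ℝ} (hW : IsGraphon W)
    (x : Fin k → ℝ) : |wgt (smp W x) F| ≤ 1 := by
  rw [abs_of_nonneg (wgt_nonneg (smp_bd hW x) F)]
  rw [← wgt_sum (smp W x)]
  exact Finset.single_le_sum (f := fun F => wgt (smp W x) F)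
    (fun F _ => wgt_nonneg (smp_bd hW x) F) (Finset.mem_univ F)

theorem indDensity_nonneg {k : ℕ} (F : SimpleGraph (Fin k)) {W : ℝ → ℝ → ℝ} (hW : IsGraphon W) :
    0 ≤ indDensity F W := by
  rw [indDensity_wgt]
  exact integral_nonneg fun x => wgt_nonneg (smp_bd hW x) F

theorem indDensity_sum {k : ℕ} {W : ℝ → ℝ → ℝ} (hW : IsGraphon W) :
    ∑ F : SimpleGraph (Fin k), indDensity F W = 1 := by
  simp only [indDensity_wgt]
  rw [← integral_finsetSum _ fun F _ => int_bd (wgt_meas F hW) 1 (wgt_abs F hW)]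
  simp [wgt_sum]

theorem adf_abs {k : ℕ} (F : SimpleGraph (Fin k)) {H : Fin k → Fin k → ℝ}
    (hH : ∀ i j, 0 ≤ H i j ∧ H i j ≤ 1) (i j : Fin k) : |adf H F i j| ≤ 1 := by
  have := hH i j
  unfold adf
  rw [abs_le]
  split_ifs <;> constructor <;> linarith

theorem adf_meas {k : ℕ} (F : SimpleGraph (Fin k)) {V : ℝ → ℝ → ℝ} (hV : K01 V) (i j : Fin k) :
    Measurable fun x : Fin k → ℝ => adf (smp V x) F i j := by
  unfold adf
  exact measurable_const.sub (hV.ker.meas₂ (measurable_pi_apply i) (measurable_pi_apply j))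

theorem abs_mul4 {a b c d : ℝ} (ha : |a| ≤ 1) (hb : |b| ≤ 1) (hc : |c| ≤ 1) (hd : |d| ≤ 1) :
    |a * b * c * d| ≤ 1 := by
  rw [abs_mul, abs_mul, abs_mul]
  exact mul_le_one₀ (mul_le_one₀ (mul_le_one₀ ha (abs_nonneg _) hb) (abs_nonneg _) hc)
    (abs_nonneg _) hd

theorem sum_ite_le {k : ℕ} : (∑ j : Fin k, ∑ m : Fin k, ∑ i : Fin k, ∑ l : Fin k,
    ((if i = l then (1 : ℝ) else 0) + (if j = m then 1 else 0) + (if i = j then 1 else 0) +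
      (if i = m then 1 else 0) + (if l = j then 1 else 0) + (if l = m then 1 else 0))) =
    6 * (k : ℝ) ^ 3 := by
  simp [Finset.sum_add_distrib]
  ring

theorem exp_M4 {k : ℕ} (hk : 1 ≤ k) {W V : ℝ → ℝ → ℝ} (hW : IsGraphon W) (hV : K01 V) :
    ∑ F : SimpleGraph (Fin k), ∫ x, wgt (smp W x) F * M4 (adf (smp V x) F) ∂(piMu k) ≤
      4 * cutNorm (fun x y => W x y - V x y) + 6 / k := by
  classical
  have hk0 : (0 : ℝ) < k := by exact_mod_cast hk
  set D : ℝ → ℝ → ℝ := fun x y => W x y - V x y with hD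
  have hDk : Ker D := hW.ker.sub hV.ker
  have hDm : ∀ a b : Fin k, Measurable fun x : Fin k → ℝ => D (x a) (x b) := fun a b =>
    hDk.meas₂ (measurable_pi_apply a) (measurable_pi_apply b)
  have hD1 : ∀ a b, |D a b| ≤ 1 := by
    intro a b
    have h1 := hW.2.2 a b
    have h2 := hV.2 a b
    rw [abs_le]
    constructor <;> simp only [hD] <;> linarith [h1.1, h1.2, h2.1, h2.2]
  have hc0 := cutNorm_nonneg hDk
  let P : SimpleGraph (Fin k) → Fin k → Fin k → Fin k → Fin k → (Fin k → ℝ) → ℝ :=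
    fun F j m i l x => adf (smp V x) F i j * adf (smp V x) F i m * adf (smp V x) F l j *
      adf (smp V x) F l m
  have hPm : ∀ F j m i l, Measurable (P F j m i l) := fun F j m i l =>
    (((adf_meas F hV i j).mul (adf_meas F hV i m)).mul (adf_meas F hV l j)).mul (adf_meas F hV l m)
  have hsV : ∀ x : Fin k → ℝ, ∀ i j, 0 ≤ smp V x i j ∧ smp V x i j ≤ 1 := fun x i j => hV.2 _ _
  have hPb : ∀ F j m i l x, |P F j m i l x| ≤ 1 := fun F j m i l x =>
    abs_mul4 (adf_abs F (hsV x) _ _) (adf_abs F (hsV x) _ _) (adf_abs F (hsV x) _ _)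
      (adf_abs F (hsV x) _ _)
  have hPi : ∀ F j m i l, Integrable (fun x => wgt (smp W x) F * P F j m i l x) (piMu k) :=
    fun F j m i l => int_bd ((wgt_meas F hW).mul (hPm F j m i l)) 1 fun x => by
      rw [abs_mul]
      exact mul_le_one₀ (wgt_abs F hW x) (abs_nonneg _) (hPb F j m i l x)
  have e1 : ∀ F, ∫ x, wgt (smp W x) F * M4 (adf (smp V x) F) ∂(piMu k) =
      (∑ j, ∑ m, ∑ i, ∑ l, ∫ x, wgt (smp W x) F * P F j m i l x ∂(piMu k)) / (k : ℝ) ^ 4 := by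
    intro F
    have : ∀ x, wgt (smp W x) F * M4 (adf (smp V x) F) =
        (∑ j, ∑ m, ∑ i, ∑ l, wgt (smp W x) F * P F j m i l x) / (k : ℝ) ^ 4 := by
      intro x
      rw [M4_eq, mul_div_assoc']
      simp only [Finset.mul_sum]
      rfl
    simp only [this]
    rw [integral_div]
    congr 1
    have i1 : ∀ j m i, Integrable (fun x => ∑ l, wgt (smp W x) F * P F j m i l x) (piMu k) :=
      fun j m i => integrable_finsetSum _ fun l _ => hPi F j m i l
    have i2 : ∀ j m, Integrable (fun x => ∑ i, ∑ l, wgt (smp W x) F * P F j m i l x) (piMu k) :=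
      fun j m => integrable_finsetSum _ fun i _ => i1 j m i
    have i3 : ∀ j, Integrable (fun x => ∑ m, ∑ i, ∑ l, wgt (smp W x) F * P F j m i l x) (piMu k) :=
      fun j => integrable_finsetSum _ fun m _ => i2 j m
    rw [integral_finsetSum _ fun j _ => i3 j]
    refine Finset.sum_congr rfl fun j _ => ?_
    rw [integral_finsetSum _ fun m _ => i2 j m]
    refine Finset.sum_congr rfl fun m _ => ?_
    rw [integral_finsetSum _ fun i _ => i1 j m i]
    refine Finset.sum_congr rfl fun i _ => ?_
    rw [integral_finsetSum _ fun l _ => hPi F j m i l]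
  simp only [e1]
  rw [← Finset.sum_div, div_le_iff₀ (by positivity)]
  have e2 : (∑ F, ∑ j, ∑ m, ∑ i, ∑ l, ∫ x, wgt (smp W x) F * P F j m i l x ∂(piMu k)) =
      ∑ j, ∑ m, ∑ i, ∑ l, ∫ x, ∑ F, wgt (smp W x) F * P F j m i l x ∂(piMu k) := by
    rw [Finset.sum_comm]
    refine Finset.sum_congr rfl fun j _ => ?_
    rw [Finset.sum_comm]
    refine Finset.sum_congr rfl fun m _ => ?_
    rw [Finset.sum_comm]
    refine Finset.sum_congr rfl fun i _ => ?_
    rw [Finset.sum_comm]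
    refine Finset.sum_congr rfl fun l _ => ?_
    rw [integral_finsetSum _ fun F _ => hPi F j m i l]
  rw [e2]
  have triv : ∀ j m i l, ∫ x, ∑ F, wgt (smp W x) F * P F j m i l x ∂(piMu k) ≤ 1 := by
    intro j m i l
    refine (le_abs_self _).trans (abs_int_le 1 fun x => ?_)
    refine (Finset.abs_sum_le_sum_abs _ _).trans ?_
    rw [← wgt_sum (smp W x)]
    refine Finset.sum_le_sum fun F _ => ?_
    have h0 := wgt_nonneg (smp_bd hW x) F
    rw [abs_mul, abs_of_nonneg h0]
    exact mul_le_of_le_one_right h0 (hPb F j m i l x)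
  have term : ∀ j m i l, ∫ x, ∑ F, wgt (smp W x) F * P F j m i l x ∂(piMu k) ≤
      4 * cutNorm D + ((if i = l then (1 : ℝ) else 0) + (if j = m then 1 else 0) +
        (if i = j then 1 else 0) + (if i = m then 1 else 0) + (if l = j then 1 else 0) +
        (if l = m then 1 else 0)) := by
    intro j m i l
    have nn : ∀ p : Prop, ∀ [Decidable p], (0 : ℝ) ≤ if p then 1 else 0 := by
      intro p _; split_ifs <;> norm_num
    have n1 := nn (i = l)
    have n2 := nn (j = m)
    have n3 := nn (i = j)
    have n4 := nn (i = m)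
    have n5 := nn (l = j)
    have n6 := nn (l = m)
    have ht := triv j m i l
    by_cases hil : i = l
    · rw [if_pos hil]; linarith
    by_cases hjm : j = m
    · rw [if_pos hjm]; linarith
    by_cases hij : i = j
    · rw [if_pos hij]; linarith
    by_cases him : i = m
    · rw [if_pos him]; linarith
    by_cases hlj : l = j
    · rw [if_pos hlj]; linarith
    by_cases hlm : l = m
    · rw [if_pos hlm]; linarith
    have e3 : ∀ x : Fin k → ℝ, ∑ F, wgt (smp W x) F * P F j m i l x =
        (D (x i) (x m) * D (x l) (x m)) * D (x l) (x j) * D (x i) (x j) := by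
      intro x
      have := graph_sum4 (U := smp W x) (fun a b => hW.2.1 _ _) (smp V x) hil hjm hij him hlj hlm
      refine this.trans ?_
      simp only [hD, smp]; ring
    simp only [e3]
    have := two_coord (A := fun x : Fin k → ℝ => D (x i) (x m) * D (x l) (x m))
      (B := fun x => D (x l) (x j)) hij hDk ((hDm i m).mul (hDm l m)) (hDm l j)
      (fun x => by rw [abs_mul]; exact mul_le_one₀ (hD1 _ _) (abs_nonneg _) (hD1 _ _))
      (fun x => hD1 _ _)
      (fun x t => by
        rw [Function.update_of_ne hij, Function.update_of_ne (Ne.symm hjm), Function.update_of_ne hlj])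
      (fun x s => by
        rw [Function.update_of_ne (Ne.symm hil), Function.update_of_ne (Ne.symm hij)])
    linarith [(le_abs_self _).trans this]
  calc ∑ j, ∑ m, ∑ i, ∑ l, ∫ x, ∑ F, wgt (smp W x) F * P F j m i l x ∂(piMu k)
      ≤ ∑ j : Fin k, ∑ m : Fin k, ∑ i : Fin k, ∑ l : Fin k,
        (4 * cutNorm D + ((if i = l then (1 : ℝ) else 0) + (if j = m then 1 else 0) +
        (if i = j then 1 else 0) + (if i = m then 1 else 0) + (if l = j then 1 else 0) +
        (if l = m then 1 else 0))) :=
        Finset.sum_le_sum fun j _ => Finset.sum_le_sum fun m _ => Finset.sum_le_sum fun i _ =>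
          Finset.sum_le_sum fun l _ => term j m i l
    _ = k ^ 4 * (4 * cutNorm D) + 6 * (k : ℝ) ^ 3 := by
        rw [← sum_ite_le]
        simp only [Finset.sum_add_distrib, Finset.sum_const, Finset.card_univ, Fintype.card_fin,
          nsmul_eq_mul]
        ring
    _ = (4 * cutNorm D + 6 / k) * k ^ 4 := by field_simp

/-! ### Empirical label frequencies -/

open Classical in
/-- Deviation of the empirical label frequency. -/
def dev {k : ℕ} {ι : Type} [MeasurableSpace ι] (q : ℝ → ι) (x : Fin k → ℝ) (a : ι) : ℝ :=
  (∑ i, ((if q (x i) = a then (1 : ℝ) else 0) - mu.real (q ⁻¹' {a}))) / k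

theorem exp_dev {k : ℕ} (hk : 1 ≤ k) {ι : Type} [MeasurableSpace ι] [MeasurableSingletonClass ι]
    {q : ℝ → ι} (hq : Measurable q) (a : ι) :
    Measurable (fun x : Fin k → ℝ => dev q x a) ∧ (∀ x : Fin k → ℝ, |dev q x a| ≤ 1) ∧
      ∫ x : Fin k → ℝ, dev q x a ^ 2 ∂(piMu k) ≤ 1 / k := by
  classical
  have hk0 : (0 : ℝ) < k := by exact_mod_cast hk
  have hms : MeasurableSet (q ⁻¹' {a}) := hq (measurableSet_singleton a)
  set lam := mu.real (q ⁻¹' {a}) with hlam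
  have l0 : 0 ≤ lam := measureReal_nonneg
  have l1 : lam ≤ 1 := measureReal_le_one
  let g : ℝ → ℝ := fun s => (q ⁻¹' {a}).indicator 1 s - lam
  have hg : Measurable g := (measurable_one.indicator hms).sub_const _
  have hg1 : ∀ s, |g s| ≤ 1 := by
    intro s
    have := (Wt.ind hms).2 s
    rw [abs_le]; constructor <;> simp only [g] <;> linarith [this.1, this.2]
  have hg0 : ∫ s, g s ∂mu = 0 := by
    simp only [g]
    rw [integral_sub, integral_indicator_one hms]
    · simp [hlam]
    · exact int_bd (measurable_one.indicator hms) 1 fun s => by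
        rw [abs_of_nonneg ((Wt.ind hms).2 s).1]; exact ((Wt.ind hms).2 s).2
    · exact integrable_const _
  have hdev : ∀ x : Fin k → ℝ, dev q x a = (∑ i, g (x i)) / k := by
    intro x
    unfold dev
    congr 1
  have hgm : ∀ i : Fin k, Measurable fun x : Fin k → ℝ => g (x i) := fun i =>
    hg.comp (measurable_pi_apply i)
  refine ⟨?_, ?_, ?_⟩
  · simp only [hdev]
    exact (Finset.measurable_sum _ fun i _ => hgm i).div_const _
  · intro x
    rw [hdev, abs_div, abs_of_pos hk0, div_le_one hk0]
    refine (Finset.abs_sum_le_sum_abs _ _).trans ?_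
    calc ∑ i, |g (x i)| ≤ ∑ i : Fin k, (1 : ℝ) := Finset.sum_le_sum fun i _ => hg1 _
      _ = k := by simp
  · have e : ∀ x : Fin k → ℝ, dev q x a ^ 2 = (∑ i, ∑ j, g (x i) * g (x j)) / k ^ 2 := by
      intro x
      rw [hdev, div_pow, sq (∑ i, g (x i)), Finset.sum_mul_sum]
    simp only [e]
    have hb : ∀ (i j : Fin k) (x : Fin k → ℝ), |g (x i) * g (x j)| ≤ 1 := fun i j x => by
      rw [abs_mul]; exact mul_le_one₀ (hg1 _) (abs_nonneg _) (hg1 _)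
    have hi : ∀ i j : Fin k, Integrable (fun x => g (x i) * g (x j)) (piMu k) := fun i j =>
      int_bd ((hgm i).mul (hgm j)) 1 (hb i j)
    rw [integral_div, integral_finsetSum _ fun i _ => integrable_finsetSum _ fun j _ => hi i j]
    have : ∀ i j : Fin k, ∫ x, g (x i) * g (x j) ∂(piMu k) ≤ if i = j then 1 else 0 := by
      intro i j
      by_cases hij : i = j
      · rw [if_pos hij]
        exact (le_abs_self _).trans (abs_int_le 1 (hb i j))
      · rw [if_neg hij, resample (f := fun x => g (x i) * g (x j)) i ((hgm i).mul (hgm j)) 1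
          (hb i j)]
        refine le_of_eq ?_
        have : ∀ (x : Fin k → ℝ) s, g (Function.update x i s i) * g (Function.update x i s j) =
            g s * g (x j) := fun x s => by
          rw [Function.update_self, Function.update_of_ne (Ne.symm hij)]
        simp only [this, integral_mul_const, hg0]
        simp
    rw [div_le_div_iff₀ (by positivity) hk0]
    have h2 : ∑ i, ∫ x, ∑ j, g (x i) * g (x j) ∂(piMu k) ≤ k := by
      calc ∑ i, ∫ x, ∑ j, g (x i) * g (x j) ∂(piMu k)
          = ∑ i : Fin k, ∑ j : Fin k, ∫ x, g (x i) * g (x j) ∂(piMu k) := by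
            refine Finset.sum_congr rfl fun i _ => ?_
            rw [integral_finsetSum _ fun j _ => hi i j]
        _ ≤ ∑ i : Fin k, ∑ j : Fin k, (if i = j then (1 : ℝ) else 0) :=
            Finset.sum_le_sum fun i _ => Finset.sum_le_sum fun j _ => this i j
        _ = k := by simp
    nlinarith

/-! ### Sampling lemma -/

open Classical in
/-- The adjacency matrix. -/
def adjM {k : ℕ} (F : SimpleGraph (Fin k)) (i j : Fin k) : ℝ := if F.Adj i j then 1 else 0

theorem adjM_bd {k : ℕ} (F : SimpleGraph (Fin k)) (i j : Fin k) : 0 ≤ adjM F i j ∧ adjM F i j ≤ 1 := by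
  unfold adjM; split_ifs <;> norm_num

theorem label_K01 {ι : Type*} [Finite ι] [MeasurableSpace ι] [MeasurableSingletonClass ι]
    {h : ι → ι → ℝ} (hh : ∀ a b, 0 ≤ h a b ∧ h a b ≤ 1) {q : ℝ → ι} (hq : Measurable q) :
    K01 fun x y => h (q x) (q y) := by
  refine ⟨?_, fun x y => hh _ _⟩
  exact (measurable_of_countable (fun z : ι × ι => h z.1 z.2)).comp
    ((hq.comp measurable_fst).prodMk (hq.comp measurable_snd))

/-- `F`, blown up to a graphon along some equipartition of `[0,1]`, is within `c` of `W`. -/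
def Close {k : ℕ} (c : ℝ) (F : SimpleGraph (Fin k)) (W : ℝ → ℝ → ℝ) : Prop :=
  ∃ p : ℝ → Fin k, Measurable p ∧ (∀ i, mu.real (p ⁻¹' {i}) = 1 / k) ∧
    cutNorm (fun x y => W x y - adjM F (p x) (p y)) ≤ c

theorem Close.mono {k : ℕ} {c c' : ℝ} {F : SimpleGraph (Fin k)} {W : ℝ → ℝ → ℝ}
    (h : Close c F W) (hc : c ≤ c') : Close c' F W := by
  obtain ⟨p, h1, h2, h3⟩ := h
  exact ⟨p, h1, h2, h3.trans hc⟩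

theorem Close.iso {k : ℕ} {c : ℝ} {F G : SimpleGraph (Fin k)} {W : ℝ → ℝ → ℝ}
    (h : Close c F W) (e : F ≃g G) : Close c G W := by
  obtain ⟨p, h1, h2, h3⟩ := h
  refine ⟨fun x => e (p x), (measurable_of_finite e).comp h1, fun i => ?_, ?_⟩
  · rw [← h2 (e.symm i)]
    congr 1
    ext x
    simp only [Set.mem_preimage, Set.mem_singleton_iff]
    constructor
    · rintro rfl; simp
    · intro h; rw [h]; simp
  · have : ∀ a b, adjM G (e a) (e b) = adjM F a b := by
      intro a b
      unfold adjM
      have hiff : G.Adj (e a) (e b) ↔ F.Adj a b := e.map_adj_iff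
      by_cases hab : F.Adj a b
      · rw [if_pos hab, if_pos (hiff.2 hab)]
      · rw [if_neg hab, if_neg fun h' => hab (hiff.1 h')]
    simpa only [this] using h3

theorem exists_equi {k : ℕ} (hk : 1 ≤ k) :
    ∃ p : ℝ → Fin k, Measurable p ∧ ∀ i, mu.real (p ⁻¹' {i}) = 1 / k := by
  have hk0 : (0 : ℝ) < k := by exact_mod_cast hk
  let p : ℝ → Fin k := fun z => ⟨min ⌊(k : ℝ) * z⌋₊ (k - 1), by omega⟩
  have hp : Measurable p := by
    have h1 : Measurable fun z : ℝ => ⌊(k : ℝ) * z⌋₊ := Nat.measurable_floor.comp (measurable_const_mul _)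
    exact (measurable_of_countable (fun n : ℕ => (⟨min n (k - 1), by omega⟩ : Fin k))).comp h1
  have hlow : ∀ i : Fin k, 1 / (k : ℝ) ≤ mu.real (p ⁻¹' {i}) := by
    intro i
    have hi : ((i : ℕ) : ℝ) + 1 ≤ k := by exact_mod_cast i.2
    have hi0 : (0 : ℝ) ≤ ((i : ℕ) : ℝ) := Nat.cast_nonneg _
    have hsub : Set.Ico (((i : ℕ) : ℝ) / k) ((((i : ℕ) : ℝ) + 1) / k) ⊆ p ⁻¹' {i} := by
      rintro z ⟨h1, h2⟩
      rw [div_le_iff₀ hk0] at h1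
      rw [lt_div_iff₀ hk0] at h2
      have : ⌊(k : ℝ) * z⌋₊ = i := by
        rw [Nat.floor_eq_iff (by linarith)]
        constructor <;> linarith
      simp only [Set.mem_preimage, Set.mem_singleton_iff, p, this]
      ext
      simp only
      have := i.2
      omega
    have hsub2 : Set.Ico (((i : ℕ) : ℝ) / k) ((((i : ℕ) : ℝ) + 1) / k) ⊆ I01 := by
      rintro z ⟨h1, h2⟩
      refine ⟨le_trans (by positivity) h1, h2.le.trans ?_⟩
      rw [div_le_one hk0]; exact hi
    have : mu.real (Set.Ico (((i : ℕ) : ℝ) / k) ((((i : ℕ) : ℝ) + 1) / k)) = 1 / k := by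
      rw [measureReal_def, mu, Measure.restrict_apply measurableSet_Ico,
        Set.inter_eq_left.2 hsub2, Real.volume_Ico, ENNReal.toReal_ofReal]
      · ring
      · rw [← sub_div]; simp
    rw [← this]
    exact measureReal_mono hsub
  have hsum : ∑ i, mu.real (p ⁻¹' {i}) = 1 := by
    rw [sum_measureReal_preimage_singleton _ fun i _ => hp (measurableSet_singleton i)]
    simp
  refine ⟨p, hp, ?_⟩
  have h0 : ∑ i : Fin k, (mu.real (p ⁻¹' {i}) - 1 / k) = 0 := by
    rw [Finset.sum_sub_distrib, hsum]
    simp [hk0.ne']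
  rw [Finset.sum_eq_zero_iff_of_nonneg fun i _ => sub_nonneg.2 (hlow i)] at h0
  exact fun i => sub_eq_zero.1 (h0 i (Finset.mem_univ i))

theorem close_one {k : ℕ} (hk : 1 ≤ k) (F : SimpleGraph (Fin k)) {W : ℝ → ℝ → ℝ}
    (hW : IsGraphon W) : Close 1 F W := by
  obtain ⟨p, hp, hu⟩ := exists_equi hk
  refine ⟨p, hp, hu, ?_⟩
  have hk1 : K01 _ := label_K01 (adjM_bd F) hp
  have := cutNorm_le_int (hW.ker.sub hk1.ker) (b := fun _ _ => 1)
    ⟨measurable_const, 1, fun _ _ => by simp⟩ (fun x y => by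
      have h1 := hW.2.2 x y
      have h2 := adjM_bd F (p x) (p y)
      rw [abs_le]; constructor <;> linarith [h1.1, h1.2, h2.1, h2.2])
  simpa using this

theorem close_of {k : ℕ} (hk : 1 ≤ k) {ι : Type} [Fintype ι] [MeasurableSpace ι]
    [MeasurableSingletonClass ι] {W : ℝ → ℝ → ℝ} (hW : IsGraphon W) {q : ℝ → ι}
    (hq : Measurable q) {h : ι → ι → ℝ} (hh : ∀ a b, 0 ≤ h a b ∧ h a b ≤ 1) (F : SimpleGraph (Fin k))
    (x : Fin k → ℝ) {η δ c : ℝ} (hc : 0 ≤ c)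
    (h1 : cutNorm (fun x y => W x y - h (q x) (q y)) ≤ η)
    (h2 : ∑ a, |dev q x a| ≤ δ)
    (h3 : M4 (adf (smp (fun s t => h (q s) (q t)) x) F) ≤ c ^ 4) :
    Close (η + 2 * δ + c) F W := by
  classical
  have hk0 : (0 : ℝ) < k := by exact_mod_cast hk
  obtain ⟨r, hr, hu⟩ := exists_equi hk
  let s : ℝ → ι := fun z => q (x (r z))
  have hs : Measurable s := (measurable_of_finite fun i => q (x i)).comp hr
  obtain ⟨ψ, hψ, hψ2⟩ := transport_approx hs hq
  have hlaw : ∀ a, mu.real (s ⁻¹' {a}) - mu.real (q ⁻¹' {a}) = dev q x a := by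
    intro a
    have e1 : s ⁻¹' {a} = r ⁻¹' ((Finset.univ.filter fun i => q (x i) = a : Finset (Fin k)) : Set (Fin k)) := by
      ext z; simp [s]
    rw [e1, ← sum_measureReal_preimage_singleton _ fun i _ => hr (measurableSet_singleton i)]
    simp only [hu, dev]
    rw [Finset.sum_sub_distrib, sub_div]
    congr 1
    · simp [Finset.sum_boole, div_eq_mul_inv]
    · simp; field_simp
  simp only [hlaw] at hψ2
  have hp : Measurable fun z => r (ψ z) := hr.comp hψ.measurable
  have hup : ∀ i, mu.real ((fun z => r (ψ z)) ⁻¹' {i}) = 1 / k := by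
    intro i
    rw [← hu i]
    exact congrArg ENNReal.toReal
      (hψ.measure_preimage (hr (measurableSet_singleton i)).nullMeasurableSet)
  refine ⟨fun z => r (ψ z), hp, hup, ?_⟩
  have hsψ : Measurable fun z => s (ψ z) := hs.comp hψ.measurable
  have k1 := label_K01 hh hq
  have k2 := label_K01 hh hsψ
  have k3 := label_K01 (adjM_bd F) hp
  have c1 := cutNorm_add_le (hW.ker.sub k1.ker) (k1.ker.sub k2.ker)
  have c2 := cutNorm_add_le ((hW.ker.sub k1.ker).add (k1.ker.sub k2.ker)) (k2.ker.sub k3.ker)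
  have l1 := cutNorm_labels h hh hq hsψ
  have l2 := cutNorm_M4 hk _ hp hup hc h3
  have e2 : mu.real {z | q z ≠ s (ψ z)} = mu.real {z | s (ψ z) ≠ q z} := by
    congr 1; ext z; exact ne_comm
  rw [e2] at l1
  have e3 : cutNorm (fun a b => h (s (ψ a)) (s (ψ b)) - adjM F (r (ψ a)) (r (ψ b))) ≤ c := by
    rw [cutNorm_sub_comm]
    exact l2
  have e4 : (fun a b => W a b - adjM F (r (ψ a)) (r (ψ b))) = fun a b =>
      (W a b - h (q a) (q b)) + (h (q a) (q b) - h (s (ψ a)) (s (ψ b))) +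
        (h (s (ψ a)) (s (ψ b)) - adjM F (r (ψ a)) (r (ψ b))) := by
    funext a b; ring
  rw [e4]
  linarith

theorem M4_meas {k : ℕ} (F : SimpleGraph (Fin k)) {V : ℝ → ℝ → ℝ} (hV : K01 V) :
    Measurable fun x : Fin k → ℝ => M4 (adf (smp V x) F) := by
  unfold M4
  refine Measurable.div_const ?_ _
  exact Finset.measurable_sum _ fun j _ => Finset.measurable_sum _ fun m _ =>
    (Finset.measurable_sum _ fun i _ => (adf_meas F hV i j).mul (adf_meas F hV i m)).pow_const 2

theorem M4_bd {k : ℕ} {A : Fin k → Fin k → ℝ} (hA : ∀ i j, |A i j| ≤ 1) : M4 A ≤ 1 := by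
  rw [M4_eq]
  refine div_le_one_of_le₀ ?_ (by positivity)
  calc (∑ j, ∑ m, ∑ i, ∑ l, A i j * A i m * A l j * A l m)
      ≤ ∑ j : Fin k, ∑ m : Fin k, ∑ i : Fin k, ∑ l : Fin k, (1 : ℝ) :=
        Finset.sum_le_sum fun j _ => Finset.sum_le_sum fun m _ => Finset.sum_le_sum fun i _ =>
          Finset.sum_le_sum fun l _ => (le_abs_self _).trans
            (abs_mul4 (hA _ _) (hA _ _) (hA _ _) (hA _ _))
    _ = (k : ℝ) ^ 4 := by simp; ring

open Classical in
theorem not_close_le {k : ℕ} (hk : 1 ≤ k) {ι : Type} [Fintype ι] [MeasurableSpace ι]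
    [MeasurableSingletonClass ι] {W : ℝ → ℝ → ℝ} (hW : IsGraphon W) {q : ℝ → ι}
    (hq : Measurable q) {h : ι → ι → ℝ} (hh : ∀ a b, 0 ≤ h a b ∧ h a b ≤ 1) {η δ c : ℝ}
    (hc : 0 < c) (hδ : 0 < δ) (h1 : cutNorm (fun x y => W x y - h (q x) (q y)) ≤ η) :
    ∑ F : SimpleGraph (Fin k), (if Close (η + 2 * δ + c) F W then 0 else indDensity F W) ≤
      (4 * η + 6 / k) / c ^ 4 + (Fintype.card ι : ℝ) ^ 2 / k / δ ^ 2 := by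
  have hk0 : (0 : ℝ) < k := by exact_mod_cast hk
  set V : ℝ → ℝ → ℝ := fun s t => h (q s) (q t) with hV
  have kV : K01 V := label_K01 hh hq
  have hsV : ∀ x : Fin k → ℝ, ∀ i j, 0 ≤ smp V x i j ∧ smp V x i j ≤ 1 := fun x i j => kV.2 _ _
  set n : ℝ := (Fintype.card ι : ℝ) with hn
  have hn0 : 0 ≤ n := Nat.cast_nonneg _
  let Q : (Fin k → ℝ) → ℝ := fun x => ∑ a, dev q x a ^ 2
  have hQ0 : ∀ x, 0 ≤ Q x := fun x => Finset.sum_nonneg fun a _ => sq_nonneg _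
  have hQm : Measurable Q := Finset.measurable_sum _ fun a _ => (exp_dev hk hq a).1.pow_const 2
  have hdb : ∀ (x : Fin k → ℝ) a, dev q x a ^ 2 ≤ 1 := fun x a => by
    rw [sq_le_one_iff_abs_le_one]; exact (exp_dev hk hq a).2.1 x
  have hQb : ∀ x, |Q x| ≤ n := fun x => by
    rw [abs_of_nonneg (hQ0 x)]
    calc Q x ≤ ∑ a : ι, (1 : ℝ) := Finset.sum_le_sum fun a _ => hdb x a
      _ = n := by simp [hn]
  have hQi : ∫ x, Q x ∂(piMu k) ≤ n / k := by
    simp only [Q]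
    rw [integral_finsetSum _ fun a _ => int_bd ((exp_dev hk hq a).1.pow_const 2) 1 fun x => by
      rw [abs_of_nonneg (sq_nonneg _)]; exact hdb x a]
    calc ∑ a, ∫ x, dev q x a ^ 2 ∂(piMu k) ≤ ∑ a : ι, 1 / (k : ℝ) :=
          Finset.sum_le_sum fun a _ => (exp_dev hk hq a).2.2
      _ = n / k := by simp [hn, div_eq_mul_inv]
  let M : SimpleGraph (Fin k) → (Fin k → ℝ) → ℝ := fun F x => M4 (adf (smp V x) F)
  have hM0 : ∀ F x, 0 ≤ M F x := fun F x => M4_nonneg _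
  have hMb : ∀ F x, |M F x| ≤ 1 := fun F x => by
    rw [abs_of_nonneg (hM0 F x)]; exact M4_bd (adf_abs F (hsV x))
  have iM : ∀ F, Integrable (fun x => wgt (smp W x) F * M F x) (piMu k) := fun F =>
    int_bd ((wgt_meas F hW).mul (M4_meas F kV)) 1 fun x => by
      rw [abs_mul]; exact mul_le_one₀ (wgt_abs F hW x) (abs_nonneg _) (hMb F x)
  have iQ : ∀ F, Integrable (fun x => wgt (smp W x) F * Q x) (piMu k) := fun F =>
    int_bd ((wgt_meas F hW).mul hQm) n fun x => by
      rw [abs_mul]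
      calc |wgt (smp W x) F| * |Q x| ≤ 1 * n :=
            mul_le_mul (wgt_abs F hW x) (hQb x) (abs_nonneg _) zero_le_one
        _ = n := one_mul n
  have iw : ∀ F : SimpleGraph (Fin k), Integrable (fun x => wgt (smp W x) F) (piMu k) := fun F =>
    int_bd (wgt_meas F hW) 1 (wgt_abs F hW)
  have step : ∀ F : SimpleGraph (Fin k),
      (if Close (η + 2 * δ + c) F W then 0 else indDensity F W) ≤
      (∫ x, wgt (smp W x) F * M F x ∂(piMu k)) / c ^ 4 +
        n / δ ^ 2 * ∫ x, wgt (smp W x) F * Q x ∂(piMu k) := by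
    intro F
    have wn := fun x : Fin k → ℝ => wgt_nonneg (smp_bd hW x) F
    split_ifs with hcl
    · have a1 : 0 ≤ ∫ x, wgt (smp W x) F * M F x ∂(piMu k) :=
        integral_nonneg fun x => mul_nonneg (wn x) (hM0 F x)
      have a2 : 0 ≤ ∫ x, wgt (smp W x) F * Q x ∂(piMu k) :=
        integral_nonneg fun x => mul_nonneg (wn x) (hQ0 x)
      positivity
    · rw [indDensity_wgt, ← integral_div, ← integral_const_mul,
        ← integral_add ((iM F).div_const _) ((iQ F).const_mul _)]
      refine integral_mono (iw F) (((iM F).div_const _).add ((iQ F).const_mul _)) fun x => ?_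
      have key : 1 ≤ M F x / c ^ 4 + n / δ ^ 2 * Q x := by
        by_contra hlt
        push Not at hlt
        have b1 : 0 ≤ M F x / c ^ 4 := div_nonneg (hM0 F x) (by positivity)
        have b2 : 0 ≤ n / δ ^ 2 * Q x := mul_nonneg (by positivity) (hQ0 x)
        have b3 : M F x / c ^ 4 ≤ 1 := by linarith
        rw [div_le_one (by positivity)] at b3
        refine hcl (close_of hk hW hq hh F x hc.le h1 ?_ b3)
        have b4 : n / δ ^ 2 * Q x ≤ 1 := by linarith
        rw [div_mul_eq_mul_div, div_le_one (by positivity)] at b4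
        refine le_of_pow_le_pow_left₀ (n := 2) (by norm_num) hδ.le (le_trans ?_ b4)
        have := sq_sum_le_card_mul_sum_sq (s := (Finset.univ : Finset ι)) (f := fun a => |dev q x a|)
        simpa only [sq_abs, Finset.card_univ] using this
      have := mul_le_mul_of_nonneg_left key (wn x)
      show wgt (smp W x) F ≤ wgt (smp W x) F * M F x / c ^ 4 + n / δ ^ 2 * (wgt (smp W x) F * Q x)
      calc wgt (smp W x) F = wgt (smp W x) F * 1 := (mul_one _).symm
        _ ≤ _ := this
        _ = _ := by ring
  refine (Finset.sum_le_sum fun F _ => step F).trans ?_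
  rw [Finset.sum_add_distrib, ← Finset.sum_div, ← Finset.mul_sum,
    ← integral_finsetSum _ fun F _ => iQ F]
  have eQ : ∀ x, ∑ F : SimpleGraph (Fin k), wgt (smp W x) F * Q x = Q x := fun x => by
    rw [← Finset.sum_mul, wgt_sum, one_mul]
  simp only [eQ]
  have hE := exp_M4 hk hW kV
  refine add_le_add (div_le_div_of_nonneg_right (hE.trans (by linarith)) (by positivity)) ?_
  calc n / δ ^ 2 * ∫ x, Q x ∂(piMu k) ≤ n / δ ^ 2 * (n / k) :=
        mul_le_mul_of_nonneg_left hQi (by positivity)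
    _ = n ^ 2 / k / δ ^ 2 := by field_simp

open Classical in
theorem sampling (η : ℝ) (hη : 0 < η) : ∃ K : ℕ, ∀ k, K ≤ k → 1 ≤ k → ∀ W, IsGraphon W →
    2 / 3 ≤ ∑ F : SimpleGraph (Fin k), (if Close η F W then indDensity F W else 0) := by
  set c := η / 4 with hc
  have hc0 : 0 < c := by positivity
  set δ := η / 8 with hδ
  have hδ0 : 0 < δ := by positivity
  set η1 := min (η / 4) (c ^ 4 / 24) with hη1
  have hη10 : 0 < η1 := by positivity
  obtain ⟨N, hN⟩ := regularity η1 hη10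
  set B : ℝ := 6 / c ^ 4 + ((4 : ℝ) ^ N) ^ 2 / δ ^ 2 with hB
  have hB0 : 0 ≤ B := by positivity
  obtain ⟨K, hK⟩ := exists_nat_ge (6 * B)
  refine ⟨K, fun k hk hk1 W hW => ?_⟩
  have hk0 : (0 : ℝ) < k := by exact_mod_cast hk1
  obtain ⟨n, hn, q, h, hq, hh, hcut⟩ := hN W hW
  have main := not_close_le hk1 hW hq hh hc0 hδ0 hcut
  have tot := indDensity_sum (k := k) hW
  have split : ∑ F : SimpleGraph (Fin k), (if Close (η1 + 2 * δ + c) F W then indDensity F W else 0) +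
      ∑ F : SimpleGraph (Fin k), (if Close (η1 + 2 * δ + c) F W then 0 else indDensity F W) = 1 := by
    rw [← Finset.sum_add_distrib, ← tot]
    refine Finset.sum_congr rfl fun F _ => ?_
    split_ifs <;> simp
  have mono : ∑ F : SimpleGraph (Fin k), (if Close (η1 + 2 * δ + c) F W then indDensity F W else 0) ≤
      ∑ F : SimpleGraph (Fin k), (if Close η F W then indDensity F W else 0) := by
    refine Finset.sum_le_sum fun F _ => ?_
    have h0 := indDensity_nonneg F hW
    by_cases h1 : Close (η1 + 2 * δ + c) F W
    · have : Close η F W := h1.mono (by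
        have : η1 ≤ η / 4 := min_le_left _ _
        rw [hδ, hc]; linarith)
      rw [if_pos h1, if_pos this]
    · rw [if_neg h1]; split_ifs <;> linarith
  have hcard : (Fintype.card (Fin (4 ^ n)) : ℝ) ^ 2 ≤ ((4 : ℝ) ^ N) ^ 2 := by
    rw [Fintype.card_fin]; push_cast
    exact pow_le_pow_left₀ (by positivity) (pow_le_pow_right₀ (by norm_num) hn) 2
  have f1 : 4 * η1 / c ^ 4 ≤ 1 / 6 := by
    rw [div_le_iff₀ (by positivity)]
    have : η1 ≤ c ^ 4 / 24 := min_le_right _ _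
    linarith
  have f2 : 6 / k / c ^ 4 + (Fintype.card (Fin (4 ^ n)) : ℝ) ^ 2 / k / δ ^ 2 ≤ 1 / 6 := by
    calc 6 / k / c ^ 4 + (Fintype.card (Fin (4 ^ n)) : ℝ) ^ 2 / k / δ ^ 2
        ≤ 6 / k / c ^ 4 + ((4 : ℝ) ^ N) ^ 2 / k / δ ^ 2 := by gcongr
      _ = B / k := by rw [hB]; field_simp
      _ ≤ 1 / 6 := by
          rw [div_le_iff₀ hk0]
          have : (K : ℝ) ≤ k := by exact_mod_cast hk
          linarith
  rw [add_div] at main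
  linarith

/-! ### The ball condition implies testability -/

theorem graphonIso_pullback {U : ℝ → ℝ → ℝ} (hU : IsGraphon U) {χ : ℝ → ℝ}
    (hχ : MeasurePreserving χ mu mu) : GraphonIso U fun x y => U (χ x) (χ y) := by
  classical
  intro k F
  unfold homDensity
  rw [cube_restrict]
  have hmp : MeasurePreserving (fun (x : Fin k → ℝ) i => χ (x i)) (piMu k) (piMu k) :=
    measurePreserving_pi _ _ fun _ => hχ
  have hm : Measurable fun x : Fin k → ℝ => ∏ i : Fin k, ∏ j : Fin k,
      if i < j ∧ F.Adj i j then U (x i) (x j) else 1 := by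
    refine Finset.measurable_prod _ fun i _ => Finset.measurable_prod _ fun j _ => ?_
    split_ifs
    · exact hU.ker.meas₂ (measurable_pi_apply i) (measurable_pi_apply j)
    · exact measurable_const
  conv_lhs => rw [← hmp.map_eq]
  rw [integral_map hmp.measurable.aemeasurable hm.aestronglyMeasurable]

theorem pullback_graphon {U : ℝ → ℝ → ℝ} (hU : IsGraphon U) {χ : ℝ → ℝ} (hχ : Measurable χ) :
    IsGraphon fun x y => U (χ x) (χ y) :=
  ⟨hU.ker.meas₂ (hχ.comp measurable_fst) (hχ.comp measurable_snd), fun _ _ => hU.2.1 _ _,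
    fun _ _ => hU.2.2 _ _⟩

theorem close_close {k : ℕ} {F : SimpleGraph (Fin k)} {U W : ℝ → ℝ → ℝ} (hU : IsGraphon U)
    (hW : IsGraphon W) {c c' : ℝ} (h : Close c F U) (h' : Close c' F W) :
    ∃ χ : ℝ → ℝ, MeasurePreserving χ mu mu ∧
      cutNorm (fun x y => W x y - U (χ x) (χ y)) ≤ c + c' := by
  obtain ⟨p, hp, hu, hc⟩ := h
  obtain ⟨p', hp', hu', hc'⟩ := h'
  obtain ⟨χ, hχ, hae⟩ := transport hp hp' fun i => (hu i).trans (hu' i).symm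
  refine ⟨χ, hχ, ?_⟩
  have hpχ : Measurable fun x => p (χ x) := hp.comp hχ.measurable
  have k1 := label_K01 (adjM_bd F) hp
  have k2 := label_K01 (adjM_bd F) hp'
  have k3 := label_K01 (adjM_bd F) hpχ
  have kU := pullback_graphon hU hχ.measurable
  have a1 := cutNorm_pullback (hU.ker.sub k1.ker) hχ
  have a2 := cutNorm_labels (adjM F) (adjM_bd F) hp' hpχ
  have a3 : mu.real {x | p' x ≠ p (χ x)} = 0 := by
    rw [measureReal_def]
    have : mu {x | p' x ≠ p (χ x)} = 0 := by
      rw [← compl_mem_ae_iff]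
      filter_upwards [hae] with x hx
      simp [hx]
    rw [this]; rfl
  rw [a3] at a2
  have b1 := cutNorm_add_le (hW.ker.sub k2.ker) (k2.ker.sub k3.ker)
  have b2 := cutNorm_add_le ((hW.ker.sub k2.ker).add (k2.ker.sub k3.ker)) (k3.ker.sub kU.ker)
  have a4 : cutNorm (fun x y => adjM F (p (χ x)) (p (χ y)) - U (χ x) (χ y)) ≤ c := by
    rw [cutNorm_sub_comm]
    exact a1.trans hc
  have e : (fun x y => W x y - U (χ x) (χ y)) = fun x y => (W x y - adjM F (p' x) (p' y)) +
      (adjM F (p' x) (p' y) - adjM F (p (χ x)) (p (χ y))) +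
      (adjM F (p (χ x)) (p (χ y)) - U (χ x) (χ y)) := by
    funext x y; ring
  rw [e]
  linarith

open Classical in
/-- The accuracy `1/n` is achieved by samples of size `k`. -/
def Good (k n : ℕ) : Prop := 1 ≤ n ∧ ∀ W, IsGraphon W →
  2 / 3 ≤ ∑ F : SimpleGraph (Fin k), (if Close (1 / n : ℝ) F W then indDensity F W else 0)

theorem good_one {k : ℕ} (hk : 1 ≤ k) : Good k 1 := by
  classical
  refine ⟨le_rfl, fun W hW => ?_⟩
  have : ∀ F : SimpleGraph (Fin k), Close (1 / (1 : ℕ) : ℝ) F W := fun F => by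
    simpa using close_one hk F hW
  simp only [this, if_true, indDensity_sum hW]
  norm_num

open Classical in
/-- The best accuracy. -/
def acc (k : ℕ) : ℕ := Nat.findGreatest (Good k) k

theorem acc_good {k : ℕ} (hk : 1 ≤ k) : Good k (acc k) := by
  classical
  exact Nat.findGreatest_spec hk (good_one hk)

theorem backward {R : Set (ℝ → ℝ → ℝ)} (hR : IsGraphonProperty R)
    (h : ∀ ε : ℝ, 0 < ε → ∃ ε' : ℝ, 0 < ε' ∧ ballCut R ε' ⊆ ball1 R ε) : GraphonTestable R := by
  classical
  let R' : GraphProp := fun k => {F | ∃ U ∈ R, Close (1 / acc k : ℝ) F U}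
  have hR'iff : ∀ k (F : SimpleGraph (Fin k)), F ∈ R' k ↔ ∃ U ∈ R, Close (1 / acc k : ℝ) F U :=
    fun k F => Iff.rfl
  refine ⟨R', ?_, ?_, ?_⟩
  · rintro n G H ⟨e⟩
    constructor
    · rintro ⟨U, hU, hc⟩
      exact ⟨U, hU, hc.iso e⟩
    · rintro ⟨U, hU, hc⟩
      exact ⟨U, hU, hc.iso e.symm⟩
  · intro W hW k hk
    have hWg := hR.1 W hW
    refine ((acc_good hk).2 W hWg).trans ?_
    unfold probIn
    refine Finset.sum_le_sum fun F _ => ?_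
    have h0 := indDensity_nonneg F hWg
    by_cases hc : Close (1 / acc k : ℝ) F W
    · rw [if_pos hc, if_pos ((hR'iff k F).2 ⟨W, hW, hc⟩)]
    · rw [if_neg hc]; split_ifs <;> linarith
  · intro ε hε
    obtain ⟨ε', hε', hball⟩ := h ε hε
    obtain ⟨n0, hn0⟩ := exists_nat_gt (2 / ε')
    have hn0' : (0 : ℝ) < n0 := lt_trans (by positivity) hn0
    have hn1 : 1 ≤ n0 := by exact_mod_cast hn0'
    obtain ⟨K, hK⟩ := sampling (1 / n0) (by positivity)
    refine ⟨max K (max n0 1), by simp, fun k hk W hW hd => ?_⟩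
    have hkK : K ≤ k := (le_max_left _ _).trans hk
    have hkn : n0 ≤ k := (le_max_left _ _).trans ((le_max_right _ _).trans hk)
    have hk1 : 1 ≤ k := (le_max_right _ _).trans ((le_max_right _ _).trans hk)
    have hgood : Good k n0 := ⟨hn1, fun W hW => hK k hkK hk1 W hW⟩
    have hacc : n0 ≤ acc k := Nat.le_findGreatest hkn hgood
    have haccle : (1 / acc k : ℝ) ≤ 1 / n0 :=
      one_div_le_one_div_of_le hn0' (by exact_mod_cast hacc)
    by_contra hlt
    push Not at hlt
    have hP := hgood.2 W hW
    have tot := indDensity_sum (k := k) hW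
    obtain ⟨F, hF1, hF2⟩ : ∃ F : SimpleGraph (Fin k), F ∈ R' k ∧ Close (1 / n0 : ℝ) F W := by
      by_contra hno
      push Not at hno
      have : probIn k W R' + ∑ F : SimpleGraph (Fin k),
          (if Close (1 / n0 : ℝ) F W then indDensity F W else 0) ≤ 1 := by
        refine le_trans ?_ tot.le
        unfold probIn
        rw [← Finset.sum_add_distrib]
        refine Finset.sum_le_sum fun F _ => ?_
        have h0 := indDensity_nonneg F hW
        by_cases hF : F ∈ R' k
        · rw [if_pos hF, if_neg (hno F hF)]; simp
        · rw [if_neg hF]; split_ifs <;> linarith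
      linarith
    obtain ⟨U, hUR, hUc⟩ := (hR'iff k F).1 hF1
    have hUg := hR.1 U hUR
    obtain ⟨χ, hχ, hcut⟩ := close_close hUg hW hUc hF2
    have hUχ : (fun x y => U (χ x) (χ y)) ∈ R :=
      (hR.2 U _ hUg (pullback_graphon hUg hχ.measurable) (graphonIso_pullback hUg hχ)).1 hUR
    have hlt2 : cutNorm (fun x y => W x y - U (χ x) (χ y)) < ε' := by
      have : 2 / (n0 : ℝ) < ε' := by
        rw [div_lt_iff₀ hε'] at hn0
        rw [div_lt_iff₀ hn0']; linarith
      have e2 : 2 / (n0 : ℝ) = 1 / n0 + 1 / n0 := by ring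
      linarith
    have hmem : W ∈ ballCut R ε' := by
      refine ⟨hW, ?_⟩
      unfold dCutSetE
      refine lt_of_le_of_lt (iInf₂_le _ hUχ) ?_
      exact (ENNReal.ofReal_lt_ofReal_iff hε').2 hlt2
    exact absurd (hball hmem).2 (not_lt.2 hd)

theorem graphon_testable_iff_ball
    (R : Set (ℝ → ℝ → ℝ)) (hR : IsGraphonProperty R) :
    GraphonTestable R ↔
      ∀ ε : ℝ, 0 < ε → ∃ ε' : ℝ, 0 < ε' ∧ ballCut R ε' ⊆ ball1 R ε := by
  exact ⟨fun h => forward hR h, fun h => backward hR h⟩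

end
end
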